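/- Let <₁ and <₂ be two linear orders on the arrangement 𝒜, with corresponding sets of standard ordered βnbc-bases βnbc₁ and βnbc₂ and corresponding elements Ξ₁(B), Ξ₂(B') ∈ A^r (each Ξ depends on λ and on the respective order). Then there is a function c : βnbc₂ × βnbc₁ → ℤ whose matrix is invertible over ℤ (determinant ±1), independent of λ, such that for every λ ∈ ℂ^n with λ(X) ≠ 0 for all dense X ∈ L ∖ {V} and for every B' ∈ βnbc₂, Ξ₂(B') ≡ Σ_{B ∈ βnbc₁} c(B', B) · Ξ₁(B) modulo ω_λ ∧ A^{r−1}. In particular, the transition matrix between the two bases {[Ξ₁(B)]} and {[Ξ₂(B')]} of A^r/(ω_λ ∧ A^{r−1}) is an integral unimodular matrix independent of λ. -/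

import Mathlib

open Module

noncomputable section

/-- An arrangement of `n` (affine) hyperplanes inside the ambient affine subspace `amb`
of the complex vector space `W`.  The linear order on the hyperplanes is the order of the
indices in `Fin n`; an arbitrary linear order is encoded by a permutation `σ` of `Fin n`,
with `i ≺ j ↔ σ i < σ j`. -/
structure HArr (W : Type) [AddCommGroup W] [Module ℂ W] (n : ℕ) where
  amb : AffineSubspace ℂ W
  amb_ne : (amb : Set W).Nonempty
  H : Fin n → AffineSubspace ℂ W
  inj : Function.Injective H
  le_amb : ∀ i, H i ≤ amb
  nonemptyH : ∀ i, ((H i : Set W)).Nonempty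
  hyp : ∀ i, finrank ℂ (H i).direction + 1 = finrank ℂ amb.direction

namespace HArr

variable {W : Type} [AddCommGroup W] [Module ℂ W] {n : ℕ}

/-- The intersection `⋂ S` of a subset of the arrangement (the ambient space for `S = ∅`). -/
def inter (A : HArr W n) (S : Finset (Fin n)) : AffineSubspace ℂ W :=
  A.amb ⊓ S.inf A.H

/-- Codimension (inside the ambient space) of an affine subspace. -/
def cd (A : HArr W n) (X : AffineSubspace ℂ W) : ℕ :=
  finrank ℂ A.amb.direction - finrank ℂ X.direction

/-- A dependent subset of the arrangement. -/
def dep (A : HArr W n) (S : Finset (Fin n)) : Prop :=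
  A.inter S ≠ ⊥ ∧ A.cd (A.inter S) < S.card

/-- An independent subset of the arrangement. -/
def indep (A : HArr W n) (S : Finset (Fin n)) : Prop :=
  A.inter S ≠ ⊥ ∧ A.cd (A.inter S) = S.card

/-- A base: a maximal independent subset. -/
def isBase (A : HArr W n) (S : Finset (Fin n)) : Prop :=
  A.indep S ∧ ∀ T, A.indep T → S ⊆ T → S = T

open scoped Classical in
/-- The rank of a subarrangement `{H i : i ∈ C}`. -/
def rankOn (A : HArr W n) (C : Finset (Fin n)) : ℕ :=
  C.powerset.sup fun S => if A.indep S then S.card else 0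

/-- The rank `r` of the arrangement. -/
def rank (A : HArr W n) : ℕ := A.rankOn Finset.univ

/-- A circuit: an inclusion-minimal dependent set. -/
def circuit (A : HArr W n) (S : Finset (Fin n)) : Prop :=
  A.dep S ∧ ∀ T ⊂ S, ¬ A.dep T

/-- A broken circuit w.r.t. the linear order given by `σ`. -/
def brokenCircuit (A : HArr W n) (σ : Equiv.Perm (Fin n)) (S : Finset (Fin n)) : Prop :=
  ∃ i ∉ S, (∀ j ∈ S, σ i < σ j) ∧ A.circuit (insert i S)

/-- An nbc set: nonempty intersection and containing no broken circuit. -/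
def nbcSet (A : HArr W n) (σ : Equiv.Perm (Fin n)) (S : Finset (Fin n)) : Prop :=
  A.inter S ≠ ⊥ ∧ ∀ T ⊆ S, ¬ A.brokenCircuit σ T

/-- An nbc-base. -/
def nbcBase (A : HArr W n) (σ : Equiv.Perm (Fin n)) (S : Finset (Fin n)) : Prop :=
  A.nbcSet σ S ∧ A.isBase S

/-- A βnbc-base. -/
def betaNbcBase (A : HArr W n) (σ : Equiv.Perm (Fin n)) (S : Finset (Fin n)) : Prop :=
  A.nbcBase σ S ∧ ∀ i ∈ S, ∃ j, σ j < σ i ∧ A.isBase (insert j (S.erase i))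

/-- Membership in the intersection poset `L(𝒜)`. -/
def memL (A : HArr W n) (X : AffineSubspace ℂ W) : Prop :=
  X ≠ ⊥ ∧ ∃ S : Finset (Fin n), A.inter S = X

/-- A maximal element of `L(𝒜)` (in the reverse-inclusion order). -/
def maximalL (A : HArr W n) (X : AffineSubspace ℂ W) : Prop :=
  A.memL X ∧ ∀ Y, A.memL Y → Y ≤ X → Y = X

open scoped Classical in
/-- The set of indices of hyperplanes containing `X`, i.e. `𝒜_X`. -/
def sub (A : HArr W n) (X : AffineSubspace ℂ W) : Finset (Fin n) :=
  Finset.univ.filter fun i => X ≤ A.H i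

/-- `X` is dense: `𝒜_X` admits no decomposition into two nonempty parts. -/
def denseL (A : HArr W n) (X : AffineSubspace ℂ W) : Prop :=
  ¬ ∃ S T : Finset (Fin n), Disjoint S T ∧ S.Nonempty ∧ T.Nonempty ∧
      S ∪ T = A.sub X ∧ A.cd (A.inter S) + A.cd (A.inter T) = A.cd X

/-- `i` is the minimum of `S` w.r.t. the linear order given by `σ`. -/
def isMin (σ : Equiv.Perm (Fin n)) (i : Fin n) (S : Finset (Fin n)) : Prop :=
  i ∈ S ∧ ∀ j ∈ S, σ i ≤ σ j

/-- The standard ordered tuple of a finite set, w.r.t. the linear order given by `σ`: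
`tup σ S p` is the element of `S` with `(p+1)`-st smallest `σ`-value. -/
def tup (σ : Equiv.Perm (Fin n)) (S : Finset (Fin n)) (p : Fin S.card) : Fin n :=
  σ.symm (((S.image ⇑σ).orderIsoOfFin (Finset.card_image_of_injective S σ.injective) p).1)

/-- The flag `ξ(B) = (X_1 > ⋯ > X_r)` of a standard ordered base:
`flag σ S p = X_{p+1} = ⋂_{k ≥ p} H_{i_k}`. -/
def flag (A : HArr W n) (σ : Equiv.Perm (Fin n)) (S : Finset (Fin n)) (p : Fin S.card) :
    AffineSubspace ℂ W :=
  A.inter (S.filter fun i => σ (tup σ S p) ≤ σ i)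

/-- Lexicographic order on standard ordered tuples (for the canonical order). -/
def lexLt (S T : Finset (Fin n)) : Prop :=
  List.Lex (· < ·) (S.sort (· ≤ ·)) (T.sort (· ≤ ·))

/-- `λ(X) = Σ_{H_i ∈ 𝒜_X} λ_i`. -/
def lamX (A : HArr W n) (lam : Fin n → ℂ) (X : AffineSubspace ℂ W) : ℂ :=
  ∑ i ∈ A.sub X, lam i

/-- `X` is unmixed (w.r.t. the order `σ`). -/
def unmixedX (A : HArr W n) (σ : Equiv.Perm (Fin n)) (X : AffineSubspace ℂ W) : Prop :=
  (∀ S, A.nbcBase σ S → A.inter S = X → A.betaNbcBase σ S) ∨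
  (∀ S, A.nbcBase σ S → A.inter S = X → ¬ A.betaNbcBase σ S)

/-- The linear order given by `σ` is unmixed. -/
def unmixedOrd (A : HArr W n) (σ : Equiv.Perm (Fin n)) : Prop :=
  ∀ X, A.maximalL X → A.unmixedX σ X

/-- Membership in the intersection poset of the deleted arrangement `𝒜 ∖ {H_{i₀}}`. -/
def memLdel (A : HArr W n) (i₀ : Fin n) (X : AffineSubspace ℂ W) : Prop :=
  X ≠ ⊥ ∧ ∃ S : Finset (Fin n), i₀ ∉ S ∧ A.inter S = X

/-- A maximal element of the intersection poset of the deleted arrangement. -/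
def maximalLdel (A : HArr W n) (i₀ : Fin n) (X : AffineSubspace ℂ W) : Prop :=
  A.memLdel i₀ X ∧ ∀ Y, A.memLdel i₀ Y → Y ≤ X → Y = X

/-- The generator `e_i` of the exterior algebra `E`. -/
def gen (i : Fin n) : ExteriorAlgebra ℂ (Fin n → ℂ) :=
  ExteriorAlgebra.ι ℂ (Pi.single i 1)

/-- `e_S = e_{i_1} ∧ ⋯ ∧ e_{i_p}` for `S = {i_1 < ⋯ < i_p}`. -/
def eS (S : Finset (Fin n)) : ExteriorAlgebra ℂ (Fin n → ℂ) :=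
  ((S.sort (· ≤ ·)).map gen).prod

/-- `∂e_S = Σ_k (−1)^{k−1} e_{S ∖ {i_k}}`. -/
def bdry (S : Finset (Fin n)) : ExteriorAlgebra ℂ (Fin n → ℂ) :=
  ∑ i ∈ S, ((-1 : ℂ) ^ (S.filter fun j => j < i).card) • eS (S.erase i)

/-- The defining relations of the Orlik–Solomon algebra. -/
inductive OSRel (A : HArr W n) :
    ExteriorAlgebra ℂ (Fin n → ℂ) → ExteriorAlgebra ℂ (Fin n → ℂ) → Prop
  | isBot : ∀ S : Finset (Fin n), A.inter S = ⊥ → OSRel A (eS S) 0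
  | isDep : ∀ S : Finset (Fin n), A.dep S → OSRel A (bdry S) 0

/-- The Orlik–Solomon algebra `A(𝒜)`: the exterior algebra modulo the ideal generated by
the `e_S` with empty intersection and the `∂e_S` with `S` dependent. -/
abbrev OS (A : HArr W n) := RingQuot (OSRel A)

/-- The quotient map `E → A(𝒜)`. -/
def osMk (A : HArr W n) : ExteriorAlgebra ℂ (Fin n → ℂ) →ₐ[ℂ] OS A :=
  RingQuot.mkAlgHom ℂ (OSRel A)

/-- `ω_i`, the image of `e_i` in the Orlik–Solomon algebra. -/
def om (A : HArr W n) (i : Fin n) : OS A := osMk A (gen i)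

/-- `ω_B`, the image of `e_B` in the Orlik–Solomon algebra. -/
def omB (A : HArr W n) (S : Finset (Fin n)) : OS A := osMk A (eS S)

/-- The degree `p` part `A^p` of the Orlik–Solomon algebra. -/
def deg (A : HArr W n) (p : ℕ) : Submodule ℂ (OS A) :=
  Submodule.span ℂ {x | ∃ S : Finset (Fin n), S.card = p ∧ x = omB A S}

/-- `ω_λ = Σ_i λ_i ω_i`. -/
def omLam (A : HArr W n) (lam : Fin n → ℂ) : OS A := ∑ i, lam i • om A i

/-- `ω_λ(X) = Σ_{H_i ∈ 𝒜_X} λ_i ω_i`. -/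
def omLamX (A : HArr W n) (lam : Fin n → ℂ) (X : AffineSubspace ℂ W) : OS A :=
  ∑ i ∈ A.sub X, lam i • om A i

/-- The form `Ξ(B) = ω_λ(X_1) ⋯ ω_λ(X_r)` attached to a standard ordered base. -/
def Xi (A : HArr W n) (σ : Equiv.Perm (Fin n)) (lam : Fin n → ℂ) (S : Finset (Fin n)) :
    OS A :=
  ((List.finRange S.card).map fun p => A.omLamX lam (A.flag σ S p)).prod

/-- The submodule `ω_λ ∧ A^p` of the Orlik-Solomon algebra. -/
def Ideg (A : HArr W n) (lam : Fin n → ℂ) (p : ℕ) : Submodule ℂ (OS A) :=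
  (A.deg p).map (LinearMap.mulLeft ℂ (A.omLam lam))

end HArr

open scoped Classical

namespace HArr

section Geometry

variable {W : Type} [AddCommGroup W] [Module ℂ W] {n : ℕ}

/-- `H_i` meets `X` in a proper nonempty subspace. -/
def act (A : HArr W n) (i : Fin n) (X : AffineSubspace ℂ W) : Prop :=
  X ⊓ A.H i ≠ ⊥ ∧ ¬ X ≤ A.H i

/-- A nonempty affine subspace of the ambient space. -/
def good (A : HArr W n) (X : AffineSubspace ℂ W) : Prop := X ≠ ⊥ ∧ X ≤ A.amb

/-- The common direction of the maximal elements of the arrangement cut out on `X` by the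
hyperplanes in `C`. -/
def dirOn (A : HArr W n) (C : Finset (Fin n)) (X : AffineSubspace ℂ W) : Submodule ℂ W :=
  X.direction ⊓ C.inf fun i => (A.H i).direction

lemma good_amb (A : HArr W n) : A.good A.amb :=
  ⟨(AffineSubspace.nonempty_iff_ne_bot _).1 A.amb_ne, le_rfl⟩

lemma exists_mem_of_ne_bot {X : AffineSubspace ℂ W} (h : X ≠ ⊥) : ∃ p, p ∈ X :=
  (AffineSubspace.nonempty_iff_ne_bot _).2 h

lemma ne_bot_of_mem {X : AffineSubspace ℂ W} {p : W} (h : p ∈ X) : X ≠ ⊥ :=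
  (AffineSubspace.nonempty_iff_ne_bot _).1 ⟨p, h⟩

lemma ne_bot_of_le {X Y : AffineSubspace ℂ W} (h : X ≠ ⊥) (hXY : X ≤ Y) : Y ≠ ⊥ := by
  rintro rfl
  exact h (le_bot_iff.1 hXY)

lemma direction_inf_of_ne_bot {X Y : AffineSubspace ℂ W} (h : X ⊓ Y ≠ ⊥) :
    (X ⊓ Y).direction = X.direction ⊓ Y.direction := by
  obtain ⟨p, hp⟩ := exists_mem_of_ne_bot h
  exact AffineSubspace.direction_inf_of_mem_inf hp

lemma le_of_direction_le {X Y : AffineSubspace ℂ W} (h : X ⊓ Y ≠ ⊥)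
    (hd : X.direction ≤ Y.direction) : X ≤ Y := by
  obtain ⟨p, hp⟩ := exists_mem_of_ne_bot h
  intro x hx
  have := AffineSubspace.vadd_mem_of_mem_direction
    (hd (AffineSubspace.vsub_mem_direction hx hp.1)) hp.2
  simpa using this

lemma act.not_direction_le {A : HArr W n} {i : Fin n} {X : AffineSubspace ℂ W}
    (h : A.act i X) : ¬ X.direction ≤ (A.H i).direction :=
  fun hd => h.2 (le_of_direction_le h.1 hd)

lemma act.direction_inf {A : HArr W n} {i : Fin n} {X : AffineSubspace ℂ W} (h : A.act i X) :
    (X ⊓ A.H i).direction = X.direction ⊓ (A.H i).direction :=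
  direction_inf_of_ne_bot h.1

lemma good.inf {A : HArr W n} {i : Fin n} {X : AffineSubspace ℂ W} (hX : A.good X)
    (h : A.act i X) : A.good (X ⊓ A.H i) := ⟨h.1, inf_le_left.trans hX.2⟩

lemma not_act_inf_self (A : HArr W n) (i : Fin n) {X Y : AffineSubspace ℂ W}
    (h : Y ≤ X ⊓ A.H i) : ¬ A.act i Y := fun h' => h'.2 (h.trans inf_le_right)

lemma dirOn_le (A : HArr W n) (C : Finset (Fin n)) (X : AffineSubspace ℂ W) :
    A.dirOn C X ≤ X.direction := inf_le_left

lemma dirOn_le_of_mem (A : HArr W n) {C : Finset (Fin n)} (X : AffineSubspace ℂ W) {i : Fin n}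
    (hi : i ∈ C) : A.dirOn C X ≤ (A.H i).direction :=
  inf_le_right.trans (Finset.inf_le hi)

lemma dirOn_insert (A : HArr W n) (C : Finset (Fin n)) (X : AffineSubspace ℂ W) (i : Fin n) :
    A.dirOn (insert i C) X = A.dirOn C X ⊓ (A.H i).direction := by
  rw [dirOn, dirOn, Finset.inf_insert, inf_assoc, inf_comm (A.H i).direction]

lemma dirOn_inf {A : HArr W n} (C : Finset (Fin n)) {X : AffineSubspace ℂ W} {i : Fin n}
    (h : X ⊓ A.H i ≠ ⊥) :
    A.dirOn C (X ⊓ A.H i) = A.dirOn C X ⊓ (A.H i).direction := by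
  rw [dirOn, dirOn, direction_inf_of_ne_bot h, inf_right_comm]

lemma dirOn_inf_of_mem {A : HArr W n} {C : Finset (Fin n)} {X : AffineSubspace ℂ W} {i : Fin n}
    (h : X ⊓ A.H i ≠ ⊥) (hi : i ∈ C) : A.dirOn C (X ⊓ A.H i) = A.dirOn C X := by
  rw [dirOn_inf C h, inf_eq_left]
  exact A.dirOn_le_of_mem X hi

lemma good.direction_le {A : HArr W n} {X : AffineSubspace ℂ W} (hX : A.good X) :
    X.direction ≤ A.amb.direction := AffineSubspace.direction_le hX.2

variable [FiniteDimensional ℂ W]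

lemma sup_direction_eq {A : HArr W n} {i : Fin n} {U : Submodule ℂ W}
    (hU : U ≤ A.amb.direction) (h : ¬ U ≤ (A.H i).direction) :
    U ⊔ (A.H i).direction = A.amb.direction := by
  refine Submodule.eq_of_le_of_finrank_le
    (sup_le hU (AffineSubspace.direction_le (A.le_amb i))) ?_
  rw [← A.hyp i]
  exact Submodule.finrank_lt_finrank_of_lt (right_lt_sup.2 h)

lemma finrank_inf_direction {A : HArr W n} {i : Fin n} {U : Submodule ℂ W}
    (hU : U ≤ A.amb.direction) (h : ¬ U ≤ (A.H i).direction) :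
    finrank ℂ (U ⊓ (A.H i).direction : Submodule ℂ W) + 1 = finrank ℂ U := by
  have := Submodule.finrank_sup_add_finrank_inf_eq U (A.H i).direction
  rw [sup_direction_eq hU h, ← A.hyp i] at this
  omega

lemma inf_direction_eq_of_le {A : HArr W n} {i j : Fin n} {U : Submodule ℂ W}
    (hU : U ≤ A.amb.direction) (hi : ¬ U ≤ (A.H i).direction) (hj : ¬ U ≤ (A.H j).direction)
    (h : U ⊓ (A.H i).direction ≤ (A.H j).direction) :
    U ⊓ (A.H i).direction = U ⊓ (A.H j).direction := by
  refine Submodule.eq_of_le_of_finrank_eq (le_inf inf_le_left h) ?_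
  have h1 := finrank_inf_direction hU hi
  have h2 := finrank_inf_direction hU hj
  omega

lemma act_iff {A : HArr W n} {i : Fin n} {X : AffineSubspace ℂ W} (hX : A.good X) :
    A.act i X ↔ ¬ X.direction ≤ (A.H i).direction := by
  refine ⟨act.not_direction_le, fun h => ⟨?_, fun h' => h (AffineSubspace.direction_le h')⟩⟩
  obtain ⟨x, hx⟩ := exists_mem_of_ne_bot hX.1
  obtain ⟨p, hp⟩ := A.nonemptyH i
  have hxp : x -ᵥ p ∈ A.amb.direction :=
    AffineSubspace.vsub_mem_direction (hX.2 hx) (A.le_amb i hp)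
  rw [← sup_direction_eq hX.direction_le h] at hxp
  obtain ⟨u, hu, w, hw, huw⟩ := Submodule.mem_sup.1 hxp
  have h1 := AffineSubspace.vadd_mem_of_mem_direction (neg_mem hu) hx
  have h2 := AffineSubspace.vadd_mem_of_mem_direction hw hp
  have h3 : -u +ᵥ x = w +ᵥ p := by
    simp only [vadd_eq_add, vsub_eq_sub] at huw ⊢
    rw [eq_sub_iff_add_eq] at huw
    rw [← huw]
    abel
  exact ne_bot_of_mem (p := -u +ᵥ x) ⟨h1, h3 ▸ h2⟩

lemma finrank_inf {A : HArr W n} {i : Fin n} {X : AffineSubspace ℂ W} (hX : A.good X)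
    (h : A.act i X) :
    finrank ℂ (X ⊓ A.H i).direction + 1 = finrank ℂ X.direction := by
  rw [h.direction_inf]
  exact finrank_inf_direction hX.direction_le h.not_direction_le

lemma act.mono {A : HArr W n} {i : Fin n} {X Y : AffineSubspace ℂ W} (hX : A.good X)
    (hY : Y ≤ X) (h : A.act i Y) : A.act i X :=
  (act_iff hX).2 fun h' => h.not_direction_le ((AffineSubspace.direction_le hY).trans h')

lemma cover_eq {A : HArr W n} {i j : Fin n} {X : AffineSubspace ℂ W} (hX : A.good X)
    (hi : A.act i X) (hj : A.act j X) (h : X ⊓ A.H i ≤ A.H j) : X ⊓ A.H i = X ⊓ A.H j := by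
  have hle : X ⊓ A.H i ≤ X ⊓ A.H j := le_inf inf_le_left h
  refine AffineSubspace.eq_of_direction_eq_of_nonempty_of_le
    (Submodule.eq_of_le_of_finrank_eq (AffineSubspace.direction_le hle) ?_)
    ((AffineSubspace.nonempty_iff_ne_bot _).2 hi.1) hle
  have h1 := finrank_inf hX hi
  have h2 := finrank_inf hX hj
  omega

lemma inf_not_le {A : HArr W n} {i j : Fin n} {X : AffineSubspace ℂ W} (hX : A.good X)
    (hi : A.act i X) (hj : A.act j X) (h : X ⊓ A.H i ≠ X ⊓ A.H j) : ¬ X ⊓ A.H i ≤ A.H j :=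
  fun h' => h (cover_eq hX hi hj h')

/-- If `X ⊓ H i ⊓ H j` has codimension two in `X` and lies in `H k`, then `X ⊓ H k` lies
strictly between. -/
lemma two_step {A : HArr W n} {i j k : Fin n} {X : AffineSubspace ℂ W} (hX : A.good X)
    (hi : A.act i X) (hj : A.act j (X ⊓ A.H i)) (hk : A.act k X)
    (h : X ⊓ A.H i ⊓ A.H j ≤ A.H k) (hne : X ⊓ A.H k ≠ X ⊓ A.H i) :
    A.act i (X ⊓ A.H k) ∧ X ⊓ A.H k ⊓ A.H i = X ⊓ A.H i ⊓ A.H j := by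
  have h1 : ¬ X ⊓ A.H k ≤ A.H i := inf_not_le hX hk hi hne
  have h2 : ¬ X ⊓ A.H i ≤ A.H k := inf_not_le hX hi hk hne.symm
  have h3 : X ⊓ A.H k ⊓ A.H i = X ⊓ A.H i ⊓ A.H k := inf_right_comm _ _ _
  have h4 : X ⊓ A.H i ⊓ A.H j ≤ X ⊓ A.H i ⊓ A.H k := le_inf inf_le_left h
  have h5 : X ⊓ A.H i ⊓ A.H k ≠ ⊥ := ne_bot_of_le hj.1 h4
  refine ⟨⟨h3 ▸ h5, h1⟩, h3.trans ?_⟩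
  exact (cover_eq (hX.inf hi) hj ⟨h5, h2⟩ h).symm

end Geometry

end HArr

namespace HArr

section Flags

variable {W : Type} [AddCommGroup W] [Module ℂ W] {n : ℕ}

/-- The proper nonempty intersections of `X` with the hyperplanes in `C`. -/
def steps (A : HArr W n) (C : Finset (Fin n)) (X : AffineSubspace ℂ W) :
    Finset (AffineSubspace ℂ W) :=
  (C.filter fun i => A.act i X).image fun i => X ⊓ A.H i

/-- Maximal flags below `X` of the arrangement cut out on `X` by the hyperplanes in `C`. -/
inductive MFlag (A : HArr W n) (C : Finset (Fin n)) :
    AffineSubspace ℂ W → List (AffineSubspace ℂ W) → Prop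
  | nil (X : AffineSubspace ℂ W) : A.steps C X = ∅ → MFlag A C X []
  | cons (X Y : AffineSubspace ℂ W) (Q : List (AffineSubspace ℂ W)) :
      Y ∈ A.steps C X → MFlag A C Y Q → MFlag A C X (Y :: Q)

/-- Formal integral combinations of flags. -/
abbrev Chains (W : Type) [AddCommGroup W] [Module ℂ W] : Type :=
  List (AffineSubspace ℂ W) →₀ ℤ

/-- The chain consisting of a single flag. -/
def fl (F : List (AffineSubspace ℂ W)) : Chains W := Finsupp.single F 1

/-- Prepending a subspace to all flags of a chain. -/
def pre (Y : AffineSubspace ℂ W) : Chains W →ₗ[ℤ] Chains W :=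
  Finsupp.lmapDomain ℤ ℤ (List.cons Y)

@[simp] lemma pre_fl (Y : AffineSubspace ℂ W) (F : List (AffineSubspace ℂ W)) :
    pre Y (fl F) = fl (Y :: F) := by
  simp [pre, fl]

/-- The relations among maximal flags: coboundaries of flags with one missing subspace. -/
inductive FlagRel (A : HArr W n) (C : Finset (Fin n)) : AffineSubspace ℂ W → Chains W → Prop
  | last (X : AffineSubspace ℂ W) : (∀ Y ∈ A.steps C X, A.steps C Y = ∅) →
      FlagRel A C X (∑ Y ∈ A.steps C X, fl [Y])
  | two (X Y Z : AffineSubspace ℂ W) (Q : List (AffineSubspace ℂ W)) :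
      Y ∈ A.steps C X → Z ∈ A.steps C Y → MFlag A C Z Q →
      FlagRel A C X (∑ T ∈ (A.steps C X).filter (Z ≤ ·), fl (T :: Z :: Q))
  | cons (X Y : AffineSubspace ℂ W) (x : Chains W) :
      Y ∈ A.steps C X → FlagRel A C Y x → FlagRel A C X (pre Y x)

/-- The submodule of chains spanned by the relations. -/
def relSub (A : HArr W n) (C : Finset (Fin n)) (X : AffineSubspace ℂ W) :
    Submodule ℤ (Chains W) :=
  Submodule.span ℤ {x | FlagRel A C X x}

/-- `H_h` is transverse to the common direction of the maximal elements of the arrangement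
cut out by `C` on `X`. -/
def sep (A : HArr W n) (h : Fin n) (X : AffineSubspace ℂ W) (C : Finset (Fin n)) : Prop :=
  ¬ A.dirOn C X ≤ (A.H h).direction

/-- `H_h` cuts out on `X` a new hyperplane, not already cut out by an element of `C`. -/
def ess (A : HArr W n) (h : Fin n) (X : AffineSubspace ℂ W) (C : Finset (Fin n)) : Prop :=
  A.act h X ∧ X ⊓ A.H h ∉ A.steps C X

variable {A : HArr W n} {C : Finset (Fin n)} {X Y : AffineSubspace ℂ W} {h : Fin n}

lemma mem_steps : Y ∈ A.steps C X ↔ ∃ i ∈ C, A.act i X ∧ X ⊓ A.H i = Y := by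
  simp [steps, and_assoc]

lemma inf_mem_steps {i : Fin n} (hi : i ∈ C) (ha : A.act i X) : X ⊓ A.H i ∈ A.steps C X :=
  mem_steps.2 ⟨i, hi, ha, rfl⟩

lemma good.step (hX : A.good X) (hY : Y ∈ A.steps C X) : A.good Y := by
  obtain ⟨i, -, ha, rfl⟩ := mem_steps.1 hY
  exact hX.inf ha

lemma le_of_mem_steps (hY : Y ∈ A.steps C X) : Y ≤ X := by
  obtain ⟨i, -, -, rfl⟩ := mem_steps.1 hY
  exact inf_le_left

lemma dirOn_step (hY : Y ∈ A.steps C X) : A.dirOn C Y = A.dirOn C X := by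
  obtain ⟨i, hi, ha, rfl⟩ := mem_steps.1 hY
  exact dirOn_inf_of_mem ha.1 hi

lemma steps_mono {C' : Finset (Fin n)} (hC : C ⊆ C') : A.steps C X ⊆ A.steps C' X := by
  intro Y hY
  obtain ⟨i, hi, ha, rfl⟩ := mem_steps.1 hY
  exact inf_mem_steps (hC hi) ha

lemma steps_insert_of_act (ha : A.act h X) :
    A.steps (insert h C) X = insert (X ⊓ A.H h) (A.steps C X) := by
  ext Y
  simp only [mem_steps, Finset.mem_insert]
  constructor
  · rintro ⟨i, rfl | hi, hai, rfl⟩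
    · exact Or.inl rfl
    · exact Or.inr ⟨i, hi, hai, rfl⟩
  · rintro (rfl | ⟨i, hi, hai, rfl⟩)
    · exact ⟨h, Or.inl rfl, ha, rfl⟩
    · exact ⟨i, Or.inr hi, hai, rfl⟩

lemma steps_insert_of_not_ess (he : ¬ A.ess h X C) :
    A.steps (insert h C) X = A.steps C X := by
  by_cases ha : A.act h X
  · rw [steps_insert_of_act ha]
    exact Finset.insert_eq_of_mem (not_not.1 fun h' => he ⟨ha, h'⟩)
  · ext Y
    simp only [mem_steps, Finset.mem_insert]
    constructor
    · rintro ⟨i, rfl | hi, hai, rfl⟩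
      · exact absurd hai ha
      · exact ⟨i, hi, hai, rfl⟩
    · rintro ⟨i, hi, hai, rfl⟩
      exact ⟨i, Or.inr hi, hai, rfl⟩

lemma pre_mem_relSub (hY : Y ∈ A.steps C X) {x : Chains W} (hx : x ∈ A.relSub C Y) :
    pre Y x ∈ A.relSub C X := by
  have : A.relSub C Y ≤ (A.relSub C X).comap (pre Y) := by
    refine Submodule.span_le.2 fun x hx => ?_
    exact Submodule.subset_span (FlagRel.cons X Y x hY hx)
  exact this hx

lemma two_mem_relSub {Z : AffineSubspace ℂ W} {Q : List (AffineSubspace ℂ W)}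
    (hY : Y ∈ A.steps C X) (hZ : Z ∈ A.steps C Y) (hQ : MFlag A C Z Q) :
    ∑ T ∈ (A.steps C X).filter (Z ≤ ·), fl (T :: Z :: Q) ∈ A.relSub C X :=
  Submodule.subset_span (FlagRel.two X Y Z Q hY hZ hQ)

lemma MFlag.congr {C' : Finset (Fin n)} {F : List (AffineSubspace ℂ W)}
    (hF : MFlag A C X F) (hC : ∀ Y ≤ X, A.steps C Y = A.steps C' Y) : MFlag A C' X F := by
  induction hF with
  | nil X hX => exact .nil X (by rw [← hC X le_rfl, hX])
  | cons X Y Q hY _ ih =>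
    exact .cons X Y Q (hC X le_rfl ▸ hY) (ih fun Z hZ => hC Z (hZ.trans (le_of_mem_steps hY)))

lemma FlagRel.congr {C' : Finset (Fin n)} {x : Chains W}
    (hx : FlagRel A C X x) (hC : ∀ Y ≤ X, A.steps C Y = A.steps C' Y) :
    FlagRel A C' X x := by
  induction hx with
  | last X hX =>
    rw [hC X le_rfl] at hX ⊢
    refine .last X fun Y hY => ?_
    rw [← hC Y (le_of_mem_steps hY), hX Y hY]
  | two X Y Z Q hY hZ hQ =>
    have hYX := le_of_mem_steps hY
    have hZY := le_of_mem_steps hZ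
    rw [hC X le_rfl] at hY ⊢
    rw [hC Y hYX] at hZ
    exact .two X Y Z Q hY hZ (hQ.congr fun T hT => hC T (hT.trans (hZY.trans hYX)))
  | cons X Y x hY _ ih =>
    exact .cons X Y x (hC X le_rfl ▸ hY) (ih fun Z hZ => hC Z (hZ.trans (le_of_mem_steps hY)))

lemma relSub_congr {C' : Finset (Fin n)} (hC : ∀ Y ≤ X, A.steps C Y = A.steps C' Y) :
    A.relSub C X = A.relSub C' X := by
  unfold relSub
  congr 1
  ext x
  exact ⟨fun h => h.congr hC, fun h => h.congr fun Y hY => (hC Y hY).symm⟩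

lemma steps_insert_inf_self (Z : AffineSubspace ℂ W) (hZ : Z ≤ X ⊓ A.H h) :
    A.steps (insert h C) Z = A.steps C Z :=
  steps_insert_of_not_ess fun he => not_act_inf_self A h hZ he.1

/-- Two elements of `C` cutting out the same subspace make a two-element interval. -/
lemma filter_steps_two {i j : Fin n} (hi : i ∈ C) (hj : j ∈ C)
    (hai : A.act i X) (haj : A.act j X)
    (hu : ∀ k ∈ C, A.act k X → X ⊓ A.H i ⊓ A.H j ≤ A.H k →
      X ⊓ A.H k = X ⊓ A.H i ∨ X ⊓ A.H k = X ⊓ A.H j) :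
    (A.steps C X).filter (X ⊓ A.H i ⊓ A.H j ≤ ·) = {X ⊓ A.H i, X ⊓ A.H j} := by
  ext T
  simp only [Finset.mem_filter, Finset.mem_insert, Finset.mem_singleton]
  constructor
  · rintro ⟨hT, hle⟩
    obtain ⟨k, hk, hak, rfl⟩ := mem_steps.1 hT
    exact hu k hk hak (hle.trans inf_le_right)
  · rintro (rfl | rfl)
    · exact ⟨inf_mem_steps hi hai, inf_le_left⟩
    · exact ⟨inf_mem_steps hj haj, by rw [inf_right_comm]; exact inf_le_left⟩

variable [FiniteDimensional ℂ W]

/-- If `H_h` cuts out a new hyperplane on a subspace of `X`, it already does so on `X`. -/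
lemma ess.mono (hX : A.good X) (hY : Y ≤ X) (he : A.ess h Y C) : A.ess h X C := by
  refine ⟨he.1.mono hX hY, fun hm => he.2 ?_⟩
  obtain ⟨k, hk, hak, hke⟩ := mem_steps.1 hm
  have hYk : Y ⊓ A.H k = Y ⊓ A.H h := by
    rw [← inf_eq_left.2 hY, inf_assoc, hke, ← inf_assoc]
  rw [← hYk]
  refine inf_mem_steps hk ⟨hYk ▸ he.1.1, fun hle => he.1.2 ?_⟩
  rw [inf_eq_left.2 hle] at hYk
  exact hYk.le.trans inf_le_right

lemma steps_insert_eq (hX : A.good X) (he : ¬ A.ess h X C) (hY : Y ≤ X) :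
    A.steps (insert h C) Y = A.steps C Y :=
  steps_insert_of_not_ess fun h' => he (h'.mono hX hY)

lemma steps_eq_empty_iff (hX : A.good X) : A.steps C X = ∅ ↔ X.direction = A.dirOn C X := by
  rw [Finset.eq_empty_iff_forall_notMem]
  constructor
  · intro h
    refine le_antisymm (le_inf le_rfl (Finset.le_inf fun i hi => ?_)) (A.dirOn_le C X)
    by_contra hc
    exact h _ (inf_mem_steps hi ((act_iff hX).2 hc))
  · intro h Y hY
    obtain ⟨i, hi, ha, -⟩ := mem_steps.1 hY
    exact ha.not_direction_le (h.le.trans (A.dirOn_le_of_mem X hi))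

/-- The exchange relation in a two-element interval. -/
lemma swap_mem_relSub {i j : Fin n} {Q : List (AffineSubspace ℂ W)} (hX : A.good X)
    (hi : i ∈ C) (hj : j ∈ C) (hai : A.act i X) (haj : A.act j (X ⊓ A.H i))
    (hQ : MFlag A C (X ⊓ A.H i ⊓ A.H j) Q)
    (hu : ∀ k ∈ C, A.act k X → X ⊓ A.H i ⊓ A.H j ≤ A.H k →
      X ⊓ A.H k = X ⊓ A.H i ∨ X ⊓ A.H k = X ⊓ A.H j) :
    fl ((X ⊓ A.H i) :: (X ⊓ A.H i ⊓ A.H j) :: Q) +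
      fl ((X ⊓ A.H j) :: (X ⊓ A.H j ⊓ A.H i) :: Q) ∈ A.relSub C X := by
  have := two_mem_relSub (inf_mem_steps hi hai) (inf_mem_steps hj haj) hQ
  rw [filter_steps_two hi hj hai (haj.mono hX inf_le_left) hu, Finset.sum_pair] at this
  · rwa [inf_right_comm X (A.H j)]
  · exact fun h => haj.2 (h ▸ inf_le_right)

/-- A flag not supported on `C` is equivalent to a chain of flags starting with the new
hyperplane. -/
lemma fl_mem_of_not_mFlag {F : List (AffineSubspace ℂ W)} (hF : MFlag A (insert h C) X F)
    (hX : A.good X) (hn : ¬ MFlag A C X F) :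
    fl F ∈ A.relSub (insert h C) X ⊔ Submodule.span ℤ
      {x | A.ess h X C ∧ ∃ Q, MFlag A C (X ⊓ A.H h) Q ∧ x = fl ((X ⊓ A.H h) :: Q)} := by
  induction hF with
  | nil X hs =>
    refine absurd (MFlag.nil X ?_) hn
    exact Finset.subset_empty.1 (hs ▸ steps_mono (Finset.subset_insert _ _))
  | cons X Y F hY hF ih =>
    by_cases hYC : Y ∈ A.steps C X
    · have hYn : ¬ MFlag A C Y F := fun h' => hn (.cons X Y F hYC h')
      have hgY := hX.step hYC
      have h1 := ih hgY hYn
      have h2 := Submodule.mem_map_of_mem (f := pre Y) h1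
      rw [pre_fl, Submodule.map_sup] at h2
      refine SetLike.le_def.1 (sup_le ?_ ?_) h2
      · rw [Submodule.map_le_iff_le_comap]
        exact fun x hx => Submodule.mem_sup_left (pre_mem_relSub hY hx)
      · rw [Submodule.map_span, Submodule.span_le]
        rintro _ ⟨_, ⟨he, Q, hQ, rfl⟩, rfl⟩
        have heX : A.ess h X C := he.mono hX (le_of_mem_steps hY)
        obtain ⟨g, hg, hag, rfl⟩ := mem_steps.1 hYC
        have hQ' : MFlag A (insert h C) (X ⊓ A.H g ⊓ A.H h) Q :=
          hQ.congr fun T hT => (steps_insert_inf_self T hT).symm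
        have hs := swap_mem_relSub (i := g) (j := h) hX (Finset.mem_insert_of_mem hg)
          (Finset.mem_insert_self h C) hag he.1 hQ' (by
            intro k hk hak hle
            rcases Finset.mem_insert.1 hk with rfl | hk
            · exact Or.inr rfl
            · left
              by_contra hne
              have hak' : A.act k (X ⊓ A.H g) :=
                ⟨ne_bot_of_le he.1.1 (le_inf inf_le_left hle),
                  inf_not_le hX hag hak fun h' => hne h'.symm⟩
              apply he.2
              rw [cover_eq hgY he.1 hak' hle]
              exact inf_mem_steps hk hak')
        have hm : fl ((X ⊓ A.H h) :: (X ⊓ A.H h ⊓ A.H g) :: Q) ∈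
            Submodule.span ℤ {x | A.ess h X C ∧
              ∃ Q, MFlag A C (X ⊓ A.H h) Q ∧ x = fl ((X ⊓ A.H h) :: Q)} := by
          refine Submodule.subset_span ⟨heX, _, .cons _ _ Q (inf_mem_steps hg ?_) ?_, rfl⟩
          · refine ⟨?_, inf_not_le hX heX.1 hag fun h' => heX.2 (h' ▸ hYC)⟩
            rw [inf_right_comm]
            exact he.1.1
          · rwa [inf_right_comm]
        rw [SetLike.mem_coe, pre_fl]
        have := sub_mem (Submodule.mem_sup_left hs) (Submodule.mem_sup_right hm)
        rwa [add_sub_cancel_right] at this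
    · have ha : A.ess h X C ∧ Y = X ⊓ A.H h := by
        obtain ⟨g, hg, hag, rfl⟩ := mem_steps.1 hY
        rcases Finset.mem_insert.1 hg with rfl | hg
        · exact ⟨⟨hag, hYC⟩, rfl⟩
        · exact absurd (inf_mem_steps hg hag) hYC
      obtain ⟨he, rfl⟩ := ha
      refine Submodule.mem_sup_right (Submodule.subset_span ⟨he, F, ?_, rfl⟩)
      exact hF.congr fun T hT => steps_insert_inf_self T hT

end Flags

end HArr

namespace HArr

section Generation

variable {W : Type} [AddCommGroup W] [Module ℂ W] {n : ℕ}

/-- The span of the flags starting with the hyperplane `X ⊓ H h`, when this is new. -/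
def newSub (A : HArr W n) (h : Fin n) (C : Finset (Fin n)) (X : AffineSubspace ℂ W) :
    Submodule ℤ (Chains W) :=
  Submodule.span ℤ
    {x | A.ess h X C ∧ ∃ Q, MFlag A C (X ⊓ A.H h) Q ∧ x = fl ((X ⊓ A.H h) :: Q)}

/-- The flag of successive intersections of `X` with the hyperplanes of a list. -/
def flagOf (A : HArr W n) : AffineSubspace ℂ W → List (Fin n) → List (AffineSubspace ℂ W)
  | _, [] => []
  | X, b :: B => (X ⊓ A.H b) :: flagOf A (X ⊓ A.H b) B

/-- The `βnbc`-bases of the arrangement cut out on `X` by the hyperplanes of a list, the list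
being in decreasing order and the bases being written in decreasing order. -/
def beta (A : HArr W n) : List (Fin n) → AffineSubspace ℂ W → Set (List (Fin n))
  | [], _ => {[]}
  | h :: t, X => {B | ¬ A.sep h X t.toFinset ∧
      (B ∈ beta A t X ∨
        A.ess h X t.toFinset ∧ ∃ B', B = h :: B' ∧ B' ∈ beta A t (X ⊓ A.H h))}

variable {A : HArr W n} {C : Finset (Fin n)} {X Y : AffineSubspace ℂ W} {h : Fin n}

lemma flagOf_cons (b : Fin n) (B : List (Fin n)) :
    A.flagOf X (b :: B) = (X ⊓ A.H b) :: A.flagOf (X ⊓ A.H b) B := rfl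

lemma sep_step (hY : Y ∈ A.steps C X) : A.sep h Y C ↔ A.sep h X C := by
  rw [sep, sep, dirOn_step hY]

lemma mem_of_mem_beta {l : List (Fin n)} {B : List (Fin n)} (hB : B ∈ A.beta l X) :
    ∀ b ∈ B, b ∈ l := by
  induction l generalizing X B with
  | nil => simp_all [beta]
  | cons h t ih =>
    obtain ⟨-, hB | ⟨-, B', rfl, hB⟩⟩ := hB
    · exact fun b hb => List.mem_cons_of_mem _ (ih hB b hb)
    · intro b hb
      rcases List.mem_cons.1 hb with rfl | hb
      · exact List.mem_cons_self
      · exact List.mem_cons_of_mem _ (ih hB b hb)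

/-- Flags of the restriction to a new hyperplane are flags. -/
lemma MFlag.cons_new {F : List (AffineSubspace ℂ W)} (hF : MFlag A C (X ⊓ A.H h) F)
    (ha : A.act h X) : MFlag A (Insert.insert h C) X ((X ⊓ A.H h) :: F) :=
  .cons _ _ _ (inf_mem_steps (Finset.mem_insert_self _ _) ha)
    (hF.congr fun T hT => (steps_insert_inf_self T hT).symm)

lemma sep.inf_ne {g : Fin n} (hs : A.sep h X C) (hg : g ∈ C)
    (hag : A.act g X) : X ⊓ A.H h ≠ X ⊓ A.H g := by
  intro he
  apply hs
  rw [← dirOn_inf_of_mem hag.1 hg]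
  exact (A.dirOn_le _ _).trans (AffineSubspace.direction_le (he ▸ inf_le_right))

/-- The chains attached to the elements of `beta` in the restriction, extended to `X`,
generate the flags starting with a new hyperplane. -/
lemma newSub_le_of {S : Set (List (Fin n))}
    (hS : A.ess h X C → ∀ F, MFlag A C (X ⊓ A.H h) F →
      fl F ∈ A.relSub C (X ⊓ A.H h) ⊔
        Submodule.span ℤ ((fun B => fl (A.flagOf (X ⊓ A.H h) B)) '' S)) :
    A.newSub h C X ≤ A.relSub (insert h C) X ⊔
      Submodule.span ℤ {x | A.ess h X C ∧ ∃ B ∈ S, x = fl (A.flagOf X (h :: B))} := by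
  refine Submodule.span_le.2 ?_
  rintro _ ⟨he, Q, hQ, rfl⟩
  have h2 := Submodule.mem_map_of_mem (f := pre (X ⊓ A.H h)) (hS he Q hQ)
  rw [Submodule.map_sup, pre_fl] at h2
  refine SetLike.le_def.1 (sup_le_sup ?_ ?_) h2
  · rw [Submodule.map_le_iff_le_comap,
      ← relSub_congr fun T hT => steps_insert_inf_self (h := h) T hT]
    exact fun x hx => pre_mem_relSub (inf_mem_steps (Finset.mem_insert_self h C) he.1) hx
  · rw [Submodule.map_span, Submodule.span_le]
    rintro _ ⟨_, ⟨B, hB, rfl⟩, rfl⟩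
    exact Submodule.subset_span ⟨he, B, hB, by rw [pre_fl, flagOf_cons]⟩

variable [FiniteDimensional ℂ W]

lemma sep.act (hX : A.good X) (hs : A.sep h X C) : A.act h X :=
  (act_iff hX).2 fun h' => hs ((A.dirOn_le C X).trans h')

lemma steps_insert_eq_empty (hX : A.good X) (hs : ¬ A.sep h X C) (he : A.steps C X = ∅) :
    A.steps (insert h C) X = ∅ := by
  rw [steps_eq_empty_iff hX] at he ⊢
  rw [dirOn_insert, ← he, eq_comm, inf_eq_left, he]
  exact not_not.1 hs

lemma MFlag.insert {F : List (AffineSubspace ℂ W)} (hF : MFlag A C X F) (hX : A.good X)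
    (hs : ¬ A.sep h X C) : MFlag A (insert h C) X F := by
  induction hF with
  | nil X he => exact .nil X (steps_insert_eq_empty hX hs he)
  | cons X Y Q hY _ ih =>
    exact .cons X Y Q (steps_mono (Finset.subset_insert _ _) hY)
      (ih (hX.step hY) (by rwa [sep_step hY]))

/-- Relations of a deletion become relations modulo flags starting with the deleted
hyperplane. -/
lemma relSub_le_insert (hX : A.good X) (hs : ¬ A.sep h X C) :
    A.relSub C X ≤ A.relSub (insert h C) X ⊔ A.newSub h C X := by
  refine Submodule.span_le.2 fun x hx => ?_
  rw [SetLike.mem_coe]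
  induction hx with
  | last X hL =>
    by_cases he : A.ess h X C
    · have hne : (A.steps C X).Nonempty := by
        rw [Finset.nonempty_iff_ne_empty]
        intro h0
        rw [steps_eq_empty_iff hX] at h0
        exact he.1.not_direction_le (h0.le.trans (not_not.1 hs))
      obtain ⟨Y, hY⟩ := hne
      have hd : (X ⊓ A.H h).direction = A.dirOn C (X ⊓ A.H h) := by
        have hYd := (steps_eq_empty_iff (hX.step hY)).1 (hL Y hY)
        rw [dirOn_step hY] at hYd
        obtain ⟨g, hg, hag, rfl⟩ := mem_steps.1 hY
        have hle : A.dirOn C X ≤ (X ⊓ A.H h).direction := by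
          rw [he.1.direction_inf]
          exact le_inf (A.dirOn_le C X) (not_not.1 hs)
        have hle' := Submodule.eq_of_le_of_finrank_eq hle (by
          have h1 := finrank_inf hX he.1
          have h2 := finrank_inf hX hag
          rw [hYd] at h2
          omega)
        rw [dirOn_inf C he.1.1, inf_eq_left.2 (not_not.1 hs), hle']
      have hnil : A.steps C (X ⊓ A.H h) = ∅ := (steps_eq_empty_iff (hX.inf he.1)).2 hd
      have hrel : ∑ Y ∈ A.steps (insert h C) X, fl [Y] ∈ A.relSub (insert h C) X := by
        refine Submodule.subset_span (.last X fun Y hY => ?_)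
        rw [steps_insert_of_act he.1, Finset.mem_insert] at hY
        rcases hY with rfl | hY
        · rw [steps_insert_inf_self _ le_rfl, hnil]
        · exact steps_insert_eq_empty (hX.step hY) (by rwa [sep_step hY]) (hL Y hY)
      rw [steps_insert_of_act he.1, Finset.sum_insert he.2] at hrel
      have hnew : fl [X ⊓ A.H h] ∈ A.newSub h C X :=
        Submodule.subset_span ⟨he, [], .nil _ hnil, rfl⟩
      have := sub_mem (Submodule.mem_sup_left hrel) (Submodule.mem_sup_right hnew)
      rwa [add_sub_cancel_left] at this
    · refine Submodule.mem_sup_left ?_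
      rw [relSub_congr fun Y hY => steps_insert_eq hX he hY]
      exact Submodule.subset_span (.last X hL)
  | two X Y Z Q hY hZ hQ =>
    have hZQ : MFlag A (insert h C) Z Q := hQ.insert ((hX.step hY).step hZ)
      (by rwa [sep_step hZ, sep_step hY])
    have hrel := two_mem_relSub (steps_mono (Finset.subset_insert h C) hY)
      (steps_mono (Finset.subset_insert h C) hZ) hZQ
    by_cases he : A.ess h X C
    · rw [steps_insert_of_act he.1, Finset.filter_insert] at hrel
      split_ifs at hrel with hle
      · rw [Finset.sum_insert fun h' => he.2 (Finset.mem_filter.1 h').1] at hrel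
        have hnew : fl ((X ⊓ A.H h) :: Z :: Q) ∈ A.newSub h C X := by
          refine Submodule.subset_span ⟨he, _, .cons _ _ _ ?_ hQ, rfl⟩
          obtain ⟨i, hi, hai, rfl⟩ := mem_steps.1 hY
          obtain ⟨j, hj, haj, rfl⟩ := mem_steps.1 hZ
          obtain ⟨h1, h2⟩ := two_step hX hai haj he.1 (hle.trans inf_le_right)
            fun h' => he.2 (h' ▸ hY)
          exact h2 ▸ inf_mem_steps hi h1
        have := sub_mem (Submodule.mem_sup_left hrel) (Submodule.mem_sup_right hnew)
        rwa [add_sub_cancel_left] at this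
      · exact Submodule.mem_sup_left hrel
    · refine Submodule.mem_sup_left ?_
      rwa [steps_insert_of_not_ess he] at hrel
  | cons X Y x hY _ ih =>
    have h2 := Submodule.mem_map_of_mem (f := pre Y)
      (ih (hX.step hY) (by rwa [sep_step hY]))
    have hY' := steps_mono (Finset.subset_insert h C) hY
    rw [Submodule.map_sup] at h2
    refine SetLike.le_def.1 (sup_le ?_ ?_) h2
    · rw [Submodule.map_le_iff_le_comap]
      exact fun x hx => Submodule.mem_sup_left (pre_mem_relSub hY' hx)
    · rw [newSub, Submodule.map_span, Submodule.span_le]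
      rintro _ ⟨_, ⟨he, Q, hQ, rfl⟩, rfl⟩
      rw [pre_fl]
      refine fl_mem_of_not_mFlag (.cons _ _ _ hY' (hQ.cons_new he.1)) hX fun hF => ?_
      cases hF with
      | cons _ _ _ _ hF =>
        cases hF with
        | cons _ _ _ hm _ => exact he.2 hm

/-- Below a transverse hyperplane, the intervals of the flags are two-element intervals. -/
lemma sep.between {g k : Fin n} (hX : A.good X) (hs : A.sep h X C) (hg : g ∈ C)
    (hag : A.act g X) (hk : k ∈ C) (hak : A.act k X) (hle : X ⊓ A.H g ⊓ A.H h ≤ A.H k) :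
    X ⊓ A.H k = X ⊓ A.H g := by
  have hgY := hX.inf hag
  have hsY : A.sep h (X ⊓ A.H g) C := (sep_step (inf_mem_steps hg hag)).2 hs
  by_contra hne
  have hah := hsY.act hgY
  have hak' : A.act k (X ⊓ A.H g) :=
    ⟨ne_bot_of_le hah.1 (le_inf inf_le_left hle), inf_not_le hX hag hak fun h' => hne h'.symm⟩
  apply hsY
  calc A.dirOn C (X ⊓ A.H g) = A.dirOn C (X ⊓ A.H g ⊓ A.H k) :=
        (dirOn_inf_of_mem hak'.1 hk).symm
    _ ≤ (X ⊓ A.H g ⊓ A.H k).direction := A.dirOn_le _ _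
    _ = (X ⊓ A.H g ⊓ A.H h).direction := by rw [cover_eq hgY hah hak' hle]
    _ ≤ (A.H h).direction := AffineSubspace.direction_le inf_le_right

/-- All flags vanish when the arrangement contains a hyperplane transverse to the others. -/
lemma sep.fl_mem_relSub {F : List (AffineSubspace ℂ W)} (hX : A.good X) (hs : A.sep h X C)
    (hF : MFlag A (insert h C) X F) : fl F ∈ A.relSub (insert h C) X := by
  induction F generalizing X with
  | nil =>
    cases hF with
    | nil _ he => exact absurd (inf_mem_steps (Finset.mem_insert_self h C) (hs.act hX)) (by simp [he])
  | cons Y F ih =>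
    have key : ∀ Y ∈ A.steps C X, MFlag A (insert h C) Y F →
        fl (Y :: F) ∈ A.relSub (insert h C) X := by
      intro Y hY hF
      rw [← pre_fl]
      exact pre_mem_relSub (steps_mono (Finset.subset_insert h C) hY)
        (ih (hX.step hY) ((sep_step hY).2 hs) hF)
    cases hF with
    | cons _ _ _ hY hF =>
      by_cases hYC : Y ∈ A.steps C X
      · exact key Y hYC hF
      · have hYh : Y = X ⊓ A.H h := by
          obtain ⟨g, hg, hag, rfl⟩ := mem_steps.1 hY
          rcases Finset.mem_insert.1 hg with rfl | hg
          · rfl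
          · exact absurd (inf_mem_steps hg hag) hYC
        subst hYh
        have hah := hs.act hX
        cases hF with
        | nil _ he =>
          have hC : A.steps C X = ∅ := by
            rw [Finset.eq_empty_iff_forall_notMem]
            intro Z hZ
            obtain ⟨k, hk, hak, rfl⟩ := mem_steps.1 hZ
            rw [steps_eq_empty_iff (hX.inf hah)] at he
            have hle : X.direction ⊓ (A.H h).direction ≤ (A.H k).direction := by
              rw [← hah.direction_inf, he]
              exact A.dirOn_le_of_mem _ (Finset.mem_insert_of_mem hk)
            apply hs
            calc A.dirOn C X ≤ X.direction ⊓ (A.H k).direction :=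
                  le_inf (A.dirOn_le _ _) (A.dirOn_le_of_mem X hk)
              _ = X.direction ⊓ (A.H h).direction :=
                  (inf_direction_eq_of_le hX.direction_le hah.not_direction_le
                    hak.not_direction_le hle).symm
              _ ≤ _ := inf_le_right
          have hst : A.steps (insert h C) X = {X ⊓ A.H h} := by
            rw [steps_insert_of_act hah, hC, insert_empty_eq]
          have hl : ∑ Y ∈ A.steps (insert h C) X, fl [Y] ∈ A.relSub (insert h C) X :=
            Submodule.subset_span (.last X (by simpa [hst] using he))
          rwa [hst, Finset.sum_singleton] at hl
        | cons _ Z Q hZ hQ =>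
          obtain ⟨g, hg, hag, rfl⟩ := mem_steps.1 hZ
          have hgC : g ∈ C := by
            rcases Finset.mem_insert.1 hg with rfl | hg
            · exact absurd hag (not_act_inf_self A g le_rfl)
            · exact hg
          have hagX : A.act g X := hag.mono hX inf_le_left
          have hsw := swap_mem_relSub hX (Finset.mem_insert_self h C) hg hah hag hQ (by
            intro k hk hak hle
            rcases Finset.mem_insert.1 hk with rfl | hk
            · exact Or.inl rfl
            · exact Or.inr (hs.between hX hgC hagX hk hak (by rwa [inf_right_comm])))
          have hgY := hX.inf hagX
          have hahY : A.act h (X ⊓ A.H g) :=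
            ((sep_step (inf_mem_steps hgC hagX)).2 hs).act hgY
          rw [inf_right_comm X (A.H h)] at hQ key
          have hk := key (X ⊓ A.H g) (inf_mem_steps hgC hagX)
            (.cons _ _ _ (inf_mem_steps (Finset.mem_insert_self h C) hahY) hQ)
          rw [inf_right_comm X (A.H h)] at hsw ⊢
          have := sub_mem hsw hk
          rwa [add_sub_cancel_right] at this

lemma mFlag_of_mem_beta {l B : List (Fin n)} (hX : A.good X) (hB : B ∈ A.beta l X) :
    MFlag A l.toFinset X (A.flagOf X B) := by
  induction l generalizing X B with
  | nil =>
    obtain rfl : B = [] := hB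
    exact .nil X (by simp [steps])
  | cons h t ih =>
    rw [List.toFinset_cons]
    obtain ⟨hs, hB | ⟨he, B', rfl, hB⟩⟩ := hB
    · exact (ih hX hB).insert hX hs
    · exact (ih (hX.inf he.1) hB).cons_new he.1

/-- The flags of the `βnbc`-bases generate all flags modulo the relations. -/
theorem fl_mem_span_beta {l : List (Fin n)} {F : List (AffineSubspace ℂ W)} (hX : A.good X)
    (hF : MFlag A l.toFinset X F) :
    fl F ∈ A.relSub l.toFinset X ⊔
      Submodule.span ℤ ((fun B => fl (A.flagOf X B)) '' A.beta l X) := by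
  induction l generalizing X F with
  | nil =>
    cases hF with
    | nil _ _ => exact Submodule.mem_sup_right (Submodule.subset_span ⟨[], rfl, rfl⟩)
    | cons _ _ _ hY _ => simp [steps] at hY
  | cons h t ih =>
    rw [List.toFinset_cons] at hF ⊢
    by_cases hs : A.sep h X t.toFinset
    · exact Submodule.mem_sup_left (hs.fl_mem_relSub hX hF)
    · have hnew : A.newSub h t.toFinset X ≤ A.relSub (insert h t.toFinset) X ⊔
          Submodule.span ℤ ((fun B => fl (A.flagOf X B)) '' A.beta (h :: t) X) := by
        refine (newSub_le_of (S := A.beta t (X ⊓ A.H h))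
          fun he F hF => ih (hX.inf he.1) hF).trans (sup_le_sup le_rfl ?_)
        refine Submodule.span_mono ?_
        rintro _ ⟨he, B, hB, rfl⟩
        exact ⟨h :: B, ⟨hs, Or.inr ⟨he, B, rfl, hB⟩⟩, rfl⟩
      by_cases hFt : MFlag A t.toFinset X F
      · refine SetLike.le_def.1 (sup_le ?_ ?_) (ih hX hFt)
        · exact (relSub_le_insert hX hs).trans (sup_le le_sup_left hnew)
        · refine le_sup_of_le_right (Submodule.span_mono (Set.image_mono fun B hB => ?_))
          exact ⟨hs, Or.inl hB⟩
      · exact SetLike.le_def.1 (sup_le le_sup_left hnew) (fl_mem_of_not_mFlag hF hX hFt)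

end Generation

end HArr

namespace HArr

section Parallel

variable {W : Type} [AddCommGroup W] [Module ℂ W] {n : ℕ}
variable {A : HArr W n} {C : Finset (Fin n)} {X Y : AffineSubspace ℂ W} {g h : Fin n}

variable [FiniteDimensional ℂ W]

/-- Restricting flags to a transverse hyperplane. -/
lemma MFlag.restrict {B : List (Fin n)} (hX : A.good X) (hs : A.sep h X C)
    (hF : MFlag A C X (A.flagOf X B)) : MFlag A C (X ⊓ A.H h) (A.flagOf (X ⊓ A.H h) B) := by
  have hah := hs.act hX
  induction B generalizing X with
  | nil =>
    cases hF with
    | nil _ he =>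
      refine .nil _ ?_
      rw [steps_eq_empty_iff hX] at he
      rw [steps_eq_empty_iff (hX.inf hah), hah.direction_inf, dirOn_inf C hah.1, he]
  | cons b B ih =>
    rw [flagOf_cons] at hF ⊢
    cases hF with
    | cons _ _ _ hY hF =>
      obtain ⟨k, hk, hak, hkb⟩ := mem_steps.1 hY
      have hsY := (sep_step hY).2 hs
      have hgY := hX.step hY
      have h1 := ih hgY hsY hF (hsY.act hgY)
      have h2 : X ⊓ A.H h ⊓ A.H k = X ⊓ A.H h ⊓ A.H b := by
        rw [inf_right_comm, hkb, inf_right_comm]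
      rw [inf_right_comm] at h1
      refine .cons _ _ _ (h2 ▸ inf_mem_steps hk ⟨?_, ?_⟩) h1
      · rw [inf_right_comm, hkb]
        exact (hsY.act hgY).1
      · exact inf_not_le hX hah hak (hs.inf_ne hk hak)

lemma MFlag.restrict_insert {B : List (Fin n)} (hX : A.good X) (hs : A.sep h X C)
    (hd : A.dirOn C X ⊓ (A.H h).direction = A.dirOn C X ⊓ (A.H g).direction)
    (hF : MFlag A C X (A.flagOf X B)) :
    MFlag A (Insert.insert h (Insert.insert g C)) (X ⊓ A.H h) (A.flagOf (X ⊓ A.H h) B) := by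
  have hah := hs.act hX
  refine ((hF.restrict hX hs).insert (h := g) (hX.inf hah) ?_).congr
    fun T hT => (steps_insert_inf_self T hT).symm
  rw [sep, not_not, dirOn_inf C hah.1, hd]
  exact inf_le_right

lemma sep.swap {b : Fin n} {Q : List (AffineSubspace ℂ W)} (hX : A.good X) (hs : A.sep h X C)
    (hb : X ⊓ A.H b ∈ A.steps C X) (hg : A.act g (X ⊓ A.H b))
    (hne : X ⊓ A.H b ⊓ A.H h ≠ X ⊓ A.H b ⊓ A.H g)
    (hQ : MFlag A (insert h (insert g C)) (X ⊓ A.H h ⊓ A.H b) Q) :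
    fl ((X ⊓ A.H h) :: (X ⊓ A.H h ⊓ A.H b) :: Q) +
      fl ((X ⊓ A.H b) :: (X ⊓ A.H b ⊓ A.H h) :: Q) ∈ A.relSub (insert h (insert g C)) X := by
  obtain ⟨k, hk, hak, hkb⟩ := mem_steps.1 hb
  have hah := hs.act hX
  have hsY := (sep_step hb).2 hs
  have hgY := hX.step hb
  have e1 : X ⊓ A.H h ⊓ A.H b = X ⊓ A.H h ⊓ A.H k := by
    rw [inf_right_comm, ← hkb, inf_right_comm]
  rw [e1] at hQ ⊢
  rw [← hkb] at hne hg hsY hgY ⊢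
  refine swap_mem_relSub hX (Finset.mem_insert_self _ _) (by simp [hk]) hah ⟨?_, ?_⟩ hQ ?_
  · rw [inf_right_comm]
    exact (hsY.act hgY).1
  · exact inf_not_le hX hah hak (hs.inf_ne hk hak)
  · intro m hm ham hle
    rw [inf_right_comm] at hle
    rcases Finset.mem_insert.1 hm with rfl | hm
    · exact Or.inl rfl
    rcases Finset.mem_insert.1 hm with rfl | hm
    · exact absurd (cover_eq hgY (hsY.act hgY) hg hle) hne
    · exact Or.inr (hs.between hX hk hak hm ham hle)

/-- Two hyperplanes which are parallel relative to the common direction of the others yield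
opposite flags. -/
theorem parallel_mem_relSub {B : List (Fin n)} (hX : A.good X) (hs : A.sep h X C)
    (gs : A.sep g X C)
    (hd : A.dirOn C X ⊓ (A.H h).direction = A.dirOn C X ⊓ (A.H g).direction)
    (hne : X ⊓ A.H h ≠ X ⊓ A.H g) (hF : MFlag A C X (A.flagOf X B)) :
    fl (A.flagOf X (h :: B)) + fl (A.flagOf X (g :: B)) ∈
      A.relSub (insert h (insert g C)) X := by
  have hah := hs.act hX
  have hag := gs.act hX
  induction B generalizing X with
  | nil =>
    cases hF with
    | nil _ he =>
      have hst : A.steps (insert h (insert g C)) X = {X ⊓ A.H h, X ⊓ A.H g} := by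
        rw [steps_insert_of_act hah, steps_insert_of_act hag, he, insert_empty_eq]
      have hdir := (steps_eq_empty_iff hX).1 he
      have hl : ∑ Y ∈ A.steps (insert h (insert g C)) X, fl [Y] ∈
          A.relSub (insert h (insert g C)) X := by
        refine Submodule.subset_span (.last X fun Y hY => ?_)
        rw [steps_eq_empty_iff (hX.step hY), dirOn_step hY, dirOn_insert, dirOn_insert,
          inf_right_comm, hd, inf_assoc, inf_idem]
        rw [hst, Finset.mem_insert, Finset.mem_singleton] at hY
        rcases hY with rfl | rfl
        · rw [hah.direction_inf, hdir, hd]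
        · rw [hag.direction_inf, hdir]
      rw [hst, Finset.sum_pair hne] at hl
      exact hl
  | cons b B ih =>
    rw [flagOf_cons] at hF
    cases hF with
    | cons _ _ _ hY hF =>
      have hgY := hX.step hY
      have hsY := (sep_step hY).2 hs
      have gsY := (sep_step hY).2 gs
      have hahY := hsY.act hgY
      have hagY := gsY.act hgY
      have hdY := hd
      rw [← dirOn_step hY] at hdY
      have hY' : X ⊓ A.H b ∈ A.steps (insert h (insert g C)) X :=
        steps_mono ((Finset.subset_insert _ _).trans (Finset.subset_insert _ _)) hY
      have hQh := hF.restrict_insert hgY hsY hdY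
      have hQg := hF.restrict_insert hgY gsY hdY.symm
      rw [Finset.insert_comm] at hQg
      simp only [flagOf_cons]
      by_cases hZ : X ⊓ A.H b ⊓ A.H h = X ⊓ A.H b ⊓ A.H g
      · have h2 := two_mem_relSub hY' (inf_mem_steps (by simp) hahY) hQh
        have hf : (A.steps (insert h (insert g C)) X).filter (X ⊓ A.H b ⊓ A.H h ≤ ·) =
            {X ⊓ A.H h, X ⊓ A.H g, X ⊓ A.H b} := by
          ext T
          simp only [Finset.mem_filter, Finset.mem_insert, Finset.mem_singleton]
          constructor
          · rintro ⟨hT, hle⟩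
            rw [steps_insert_of_act hah, steps_insert_of_act hag, Finset.mem_insert,
              Finset.mem_insert] at hT
            rcases hT with rfl | rfl | hT
            · exact Or.inl rfl
            · exact Or.inr (Or.inl rfl)
            · obtain ⟨k, hk, hak, rfl⟩ := mem_steps.1 hT
              obtain ⟨m, hm, ham, hmb⟩ := mem_steps.1 hY
              rw [← hmb] at hle ⊢
              exact Or.inr (Or.inr (hs.between hX hm ham hk hak (hle.trans inf_le_right)))
          · rintro (rfl | rfl | rfl)
            · exact ⟨inf_mem_steps (by simp) hah, inf_le_inf_right _ inf_le_left⟩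
            · exact ⟨inf_mem_steps (by simp) hag, hZ ▸ inf_le_inf_right _ inf_le_left⟩
            · exact ⟨hY', inf_le_left⟩
        obtain ⟨m, hm, ham, hmb⟩ := mem_steps.1 hY
        have n1 : X ⊓ A.H h ≠ X ⊓ A.H b := hmb ▸ hs.inf_ne hm ham
        have n2 : X ⊓ A.H g ≠ X ⊓ A.H b := hmb ▸ gs.inf_ne hm ham
        rw [hf, Finset.sum_insert (by simp [hne, n1]), Finset.sum_pair n2, ← add_assoc] at h2
        have h3 : fl ((X ⊓ A.H b ⊓ A.H h) :: A.flagOf (X ⊓ A.H b ⊓ A.H h) B) ∈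
            A.relSub (insert h (insert g C)) (X ⊓ A.H b) := by
          have hng : ¬ A.ess g (X ⊓ A.H b) (insert h C) := fun h' =>
            h'.2 (hZ ▸ inf_mem_steps (by simp) hahY)
          have hc : ∀ T ≤ X ⊓ A.H b,
              A.steps (insert g (insert h C)) T = A.steps (insert h C) T :=
            fun T hT => steps_insert_eq hgY hng hT
          rw [Finset.insert_comm h g] at hQh ⊢
          rw [relSub_congr hc]
          refine hsY.fl_mem_relSub hgY (.cons _ _ _ (inf_mem_steps (by simp) hahY) ?_)
          exact hQh.congr fun T hT => hc T (hT.trans inf_le_left)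
        have h4 := pre_mem_relSub hY' h3
        rw [pre_fl] at h4
        have := sub_mem h2 h4
        rw [add_sub_cancel_right] at this
        rwa [inf_right_comm X (A.H h), inf_right_comm X (A.H g), ← hZ]
      · have h1 := pre_mem_relSub hY' (ih hgY hsY gsY hdY hZ hF hahY hagY)
        simp only [flagOf_cons, map_add, pre_fl] at h1
        have e1 := inf_right_comm X (A.H b) (A.H h)
        have e2 := inf_right_comm X (A.H b) (A.H g)
        have h2 := hs.swap hX hY hagY hZ (Q := A.flagOf (X ⊓ A.H b ⊓ A.H h) B)
          (by rwa [← e1])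
        have h3 := gs.swap hX hY hahY (Ne.symm hZ) (Q := A.flagOf (X ⊓ A.H b ⊓ A.H g) B)
          (by rwa [← e2, Finset.insert_comm])
        rw [Finset.insert_comm g h] at h3
        have := sub_mem (add_mem h2 h3) h1
        rw [← e1, ← e2]
        convert this using 1
        rw [← e1, ← e2]
        abel


end Parallel

end HArr

section Unimodular

variable {M M' ι κ τ : Type*} [AddCommGroup M] [AddCommGroup M']

/-- Two families agree modulo `N` up to an integral unimodular change of basis. -/
def UniEquiv (N : Submodule ℤ M) (u : ι → M) (v : κ → M) : Prop :=
  ∃ e : (ι →₀ ℤ) ≃ₗ[ℤ] (κ →₀ ℤ),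
    ∀ x, Finsupp.linearCombination ℤ u x - Finsupp.linearCombination ℤ v (e x) ∈ N

lemma mem_of_forall_single {N : Submodule ℤ M} {f : (ι →₀ ℤ) →ₗ[ℤ] M}
    (h : ∀ i, f (Finsupp.single i 1) ∈ N) (x : ι →₀ ℤ) : f x ∈ N := by
  induction x using Finsupp.induction_linear with
  | zero => simp
  | add x y hx hy => simpa using add_mem hx hy
  | single i m =>
    rw [← mul_one m, ← smul_eq_mul, ← Finsupp.smul_single, map_smul]
    exact N.smul_mem _ (h i)

lemma UniEquiv.trans {N : Submodule ℤ M} {u : ι → M} {v : κ → M} {w : τ → M}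
    (h₁ : UniEquiv N u v) (h₂ : UniEquiv N v w) : UniEquiv N u w := by
  obtain ⟨e₁, h₁⟩ := h₁
  obtain ⟨e₂, h₂⟩ := h₂
  refine ⟨e₁.trans e₂, fun x => ?_⟩
  simpa using add_mem (h₁ x) (h₂ (e₁ x))

lemma UniEquiv.map {N : Submodule ℤ M} {u : ι → M} {v : κ → M} (h : UniEquiv N u v)
    {N' : Submodule ℤ M'} (f : M →ₗ[ℤ] M') (hf : N ≤ N'.comap f) :
    UniEquiv N' (f ∘ u) (f ∘ v) := by
  obtain ⟨e, h⟩ := h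
  refine ⟨e, fun x => ?_⟩
  have := hf (h x)
  rwa [Submodule.mem_comap, map_sub, Finsupp.apply_linearCombination,
    Finsupp.apply_linearCombination] at this

lemma UniEquiv.of_equiv {N : Submodule ℤ M} {u : ι → M} {v : κ → M} (e : ι ≃ κ)
    (s : ι → ℤˣ) (h : ∀ i, u i - (s i : ℤ) • v (e i) ∈ N) : UniEquiv N u v := by
  refine ⟨LinearEquiv.ofLinearMap
    (Finsupp.linearCombination ℤ fun i => Finsupp.single (e i) (s i : ℤ))
    (Finsupp.linearCombination ℤ fun k =>
      Finsupp.single (e.symm k) ((s (e.symm k) : ℤˣ) : ℤ)) ?_ ?_, fun x => ?_⟩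
  · ext k
    simp
  · ext i
    simp
  · exact mem_of_forall_single
      (f := Finsupp.linearCombination ℤ u - Finsupp.linearCombination ℤ v ∘ₗ
        (Finsupp.linearCombination ℤ fun i => Finsupp.single (e i) (s i : ℤ)))
      (fun i => by simpa using h i) x

lemma UniEquiv.of_maps {L : Type*} {N : Submodule ℤ M} {u : L → M} {S T : Set L} (f : L → L)
    (hS : ∀ B ∈ S, f B ∈ T) (hT : ∀ B ∈ T, f B ∈ S) (hfS : ∀ B ∈ S, f (f B) = B)
    (hfT : ∀ B ∈ T, f (f B) = B) (h : ∀ B ∈ S, u B - u (f B) ∈ N ∨ u B + u (f B) ∈ N) :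
    UniEquiv N (fun B : S => u B) (fun B : T => u B) := by
  refine .of_equiv ⟨fun B => ⟨f B, hS B B.2⟩, fun B => ⟨f B, hT B B.2⟩,
    fun B => Subtype.ext (hfS B B.2), fun B => Subtype.ext (hfT B B.2)⟩
    (fun B => if u B - u (f B) ∈ N then 1 else -1) fun B => ?_
  dsimp only [Equiv.coe_fn_mk]
  split_ifs with hB
  · simpa using hB
  · simpa using (h B B.2).resolve_left hB

lemma UniEquiv.sum {ι₁ ι₂ κ₁ κ₂ : Type*} {N N' : Submodule ℤ M} {u₁ : ι₁ → M} {v₁ : κ₁ → M}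
    {u₂ : ι₂ → M} {v₂ : κ₂ → M} (h₁ : UniEquiv N' u₁ v₁)
    (hN : N' ≤ N ⊔ Submodule.span ℤ (Set.range v₂)) (h₂ : UniEquiv N u₂ v₂) :
    UniEquiv N (Sum.elim u₁ u₂) (Sum.elim v₁ v₂) := by
  obtain ⟨e₁, h₁⟩ := h₁
  obtain ⟨e₂, h₂⟩ := h₂
  have hy : ∀ i, ∃ y : κ₂ →₀ ℤ, u₁ i - Finsupp.linearCombination ℤ v₁
      (e₁ (Finsupp.single i 1)) - Finsupp.linearCombination ℤ v₂ y ∈ N := by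
    intro i
    have h3 := hN (h₁ (Finsupp.single i 1))
    obtain ⟨a, ha, b, hb, hab⟩ := Submodule.mem_sup.1 h3
    rw [← Finsupp.range_linearCombination] at hb
    obtain ⟨y, rfl⟩ := hb
    refine ⟨y, ?_⟩
    rw [Finsupp.linearCombination_single, one_smul] at hab
    rwa [← hab, add_sub_cancel_right]
  choose y hy using hy
  refine ⟨((Finsupp.sumFinsuppLEquivProdFinsupp ℤ).trans
    (LinearEquiv.skewProd e₁ e₂ (Finsupp.linearCombination ℤ y))).trans
    (Finsupp.sumFinsuppLEquivProdFinsupp ℤ).symm, fun x => ?_⟩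
  have key : ∀ (a : κ₁ →₀ ℤ) (b : κ₂ →₀ ℤ), Finsupp.linearCombination ℤ (Sum.elim v₁ v₂)
      ((Finsupp.sumFinsuppLEquivProdFinsupp ℤ).symm (a, b)) =
      Finsupp.linearCombination ℤ v₁ a + Finsupp.linearCombination ℤ v₂ b := by
    intro a b
    have : (Finsupp.sumFinsuppLEquivProdFinsupp ℤ).symm (a, b) =
        Finsupp.mapDomain Sum.inl a + Finsupp.mapDomain Sum.inr b := by
      rw [LinearEquiv.symm_apply_eq]
      ext k <;> simp [Finsupp.mapDomain_apply Sum.inl_injective,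
        Finsupp.mapDomain_apply Sum.inr_injective, Finsupp.mapDomain_of_notMem_range]
    rw [this, map_add, Finsupp.linearCombination_mapDomain, Finsupp.linearCombination_mapDomain]
    rfl
  refine mem_of_forall_single (f := Finsupp.linearCombination ℤ (Sum.elim u₁ u₂) -
    Finsupp.linearCombination ℤ (Sum.elim v₁ v₂) ∘ₗ
      (((Finsupp.sumFinsuppLEquivProdFinsupp ℤ).trans
        (LinearEquiv.skewProd e₁ e₂ (Finsupp.linearCombination ℤ y))).trans
        (Finsupp.sumFinsuppLEquivProdFinsupp ℤ).symm).toLinearMap) ?_ x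
  have hl : ∀ i, Finsupp.sumFinsuppLEquivProdFinsupp ℤ
      (Finsupp.single (Sum.inl i : ι₁ ⊕ ι₂) (1 : ℤ)) = (Finsupp.single i 1, 0) := by
    intro i
    ext k <;> simp [Finsupp.single_apply]
  have hr : ∀ i, Finsupp.sumFinsuppLEquivProdFinsupp ℤ
      (Finsupp.single (Sum.inr i : ι₁ ⊕ ι₂) (1 : ℤ)) = (0, Finsupp.single i 1) := by
    intro i
    ext k <;> simp [Finsupp.single_apply]
  rintro (i | i)
  · have := hy i
    simp only [LinearMap.sub_apply, LinearMap.comp_apply, LinearEquiv.coe_coe,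
      LinearEquiv.trans_apply, hl, LinearEquiv.skewProd_apply, key]
    simpa [sub_sub] using this
  · have := h₂ (Finsupp.single i 1)
    simp only [LinearMap.sub_apply, LinearMap.comp_apply, LinearEquiv.coe_coe,
      LinearEquiv.trans_apply, hr, LinearEquiv.skewProd_apply, key]
    simpa using this

end Unimodular

namespace HArr

section Permutation

variable {W : Type} [AddCommGroup W] [Module ℂ W] {n : ℕ}
variable {A : HArr W n} {C : Finset (Fin n)} {X Y : AffineSubspace ℂ W} {g h : Fin n}

lemma ess.notMem (he : A.ess h X C) : h ∉ C := fun hC => he.2 (inf_mem_steps hC he.1)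

lemma mem_beta_cons {t B : List (Fin n)} : B ∈ A.beta (h :: t) X ↔
    ¬ A.sep h X t.toFinset ∧ (B ∈ A.beta t X ∨
      A.ess h X t.toFinset ∧ ∃ B', B = h :: B' ∧ B' ∈ A.beta t (X ⊓ A.H h)) := Iff.rfl

lemma beta_cons_of_sep {t : List (Fin n)} (hs : A.sep h X t.toFinset) :
    A.beta (h :: t) X = ∅ := by
  ext B
  simp [mem_beta_cons, hs]

lemma beta_cons_of_not_ess {t : List (Fin n)} (hs : ¬ A.sep h X t.toFinset)
    (he : ¬ A.ess h X t.toFinset) : A.beta (h :: t) X = A.beta t X := by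
  ext B
  simp [mem_beta_cons, hs, he]

/-- The decomposition of the set `beta` according to membership of the largest hyperplane. -/
def betaSumEquiv {t : List (Fin n)} (hs : ¬ A.sep h X t.toFinset) (he : A.ess h X t.toFinset) :
    A.beta t X ⊕ A.beta t (X ⊓ A.H h) ≃ A.beta (h :: t) X :=
  Equiv.ofBijective
    (Sum.elim (fun B => ⟨B, hs, Or.inl B.2⟩) (fun B => ⟨h :: B, hs, Or.inr ⟨he, B, rfl, B.2⟩⟩)) <| by
    have hn : h ∉ t := fun ht => he.notMem (List.mem_toFinset.2 ht)
    constructor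
    · rintro (⟨B, hB⟩ | ⟨B, hB⟩) (⟨B', hB'⟩ | ⟨B', hB'⟩) hBB <;>
        replace hBB := congrArg Subtype.val hBB <;> dsimp at hBB
      · simp [hBB]
      · exact absurd (mem_of_mem_beta hB h (by simp [hBB])) hn
      · exact absurd (mem_of_mem_beta hB' h (by simp [← hBB])) hn
      · simpa using hBB
    · rintro ⟨B, -, hB | ⟨-, B', rfl, hB⟩⟩
      · exact ⟨Sum.inl ⟨B, hB⟩, rfl⟩
      · exact ⟨Sum.inr ⟨B', hB⟩, rfl⟩

lemma betaSumEquiv_inl {t : List (Fin n)} (hs : ¬ A.sep h X t.toFinset)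
    (he : A.ess h X t.toFinset) (B : A.beta t X) :
    (betaSumEquiv hs he (Sum.inl B) : List (Fin n)) = B := rfl

lemma betaSumEquiv_inr {t : List (Fin n)} (hs : ¬ A.sep h X t.toFinset)
    (he : A.ess h X t.toFinset) (B : A.beta t (X ⊓ A.H h)) :
    (betaSumEquiv hs he (Sum.inr B) : List (Fin n)) = h :: (B : List (Fin n)) := rfl

variable [FiniteDimensional ℂ W]

lemma sep.ess (hX : A.good X) (hs : A.sep h X C) : A.ess h X C := by
  refine ⟨hs.act hX, fun hm => ?_⟩
  obtain ⟨m, hm, ham, he⟩ := mem_steps.1 hm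
  exact hs.inf_ne hm ham he.symm

lemma sep_inf_iff_of_sep {k : Fin n} (hX : A.good X) (hs : A.sep h X (insert k C)) :
    A.sep k (X ⊓ A.H h) C ↔ A.sep k X C := by
  have hs' : A.sep h X C := fun h' => hs ((dirOn_insert A C X k).le.trans (inf_le_left.trans h'))
  have hah := hs'.act hX
  rw [sep, sep, dirOn_inf C hah.1, not_iff_not]
  refine ⟨fun hk => ?_, inf_le_left.trans⟩
  by_contra hc
  apply hs
  rw [dirOn_insert, ← inf_direction_eq_of_le ((A.dirOn_le C X).trans hX.direction_le) hs' hc hk]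
  exact inf_le_right

lemma ess_inf_iff_of_sep {k : Fin n} (hX : A.good X) (hs : A.sep h X (insert k C)) :
    A.ess k (X ⊓ A.H h) C ↔ A.ess k X C := by
  have hah := hs.act hX
  refine ⟨fun he => he.mono hX inf_le_left, fun he => ⟨(act_iff (hX.inf hah)).2 fun hd => ?_, ?_⟩⟩
  · rw [hah.direction_inf] at hd
    apply hs
    calc A.dirOn (insert k C) X ≤ X.direction ⊓ (A.H k).direction :=
          le_inf (A.dirOn_le _ _) (A.dirOn_le_of_mem X (Finset.mem_insert_self k C))
      _ = X.direction ⊓ (A.H h).direction := (inf_direction_eq_of_le hX.direction_le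
          hah.not_direction_le he.1.not_direction_le hd).symm
      _ ≤ _ := inf_le_right
  · intro hm
    obtain ⟨m, hm, ham, hmk⟩ := mem_steps.1 hm
    have ham' := ham.mono hX inf_le_left
    refine he.2 ((hs.between hX (Finset.mem_insert_of_mem hm) ham' (Finset.mem_insert_self k C)
      he.1 ?_) ▸ inf_mem_steps hm ham')
    rw [inf_right_comm, hmk]
    exact inf_le_right

/-- Restricting to a transverse hyperplane does not change the set of bases. -/
lemma beta_inf_of_sep {t : List (Fin n)} (hX : A.good X) (hs : A.sep h X t.toFinset) :
    A.beta t (X ⊓ A.H h) = A.beta t X := by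
  induction t generalizing X with
  | nil => rfl
  | cons k t ih =>
    rw [List.toFinset_cons] at hs
    have hs' : A.sep h X t.toFinset :=
      fun h' => hs ((dirOn_insert A _ X k).le.trans (inf_le_left.trans h'))
    ext B
    rw [mem_beta_cons, mem_beta_cons, sep_inf_iff_of_sep hX hs, ess_inf_iff_of_sep hX hs,
      ih hX hs', inf_right_comm]
    refine and_congr_right fun _ => or_congr_right (and_congr_right fun he => ?_)
    rw [ih (hX.inf he.1)]
    rwa [sep, dirOn_inf _ he.1.1, ← dirOn_insert]

lemma beta_swap_of_not_ess {t : List (Fin n)} (hX : A.good X) (he : ¬ A.ess h X t.toFinset) :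
    A.beta (h :: g :: t) X = A.beta (g :: h :: t) X := by
  have hs : ∀ Y ≤ X, A.good Y → ¬ A.sep h Y t.toFinset :=
    fun Y hY hgY hs => he ((hs.ess hgY).mono hX hY)
  have hD : A.dirOn (insert h t.toFinset) X = A.dirOn t.toFinset X := by
    rw [dirOn_insert, inf_eq_left]
    exact not_not.1 (hs X le_rfl hX)
  rw [beta_cons_of_not_ess (h := h)]
  · ext B
    rw [mem_beta_cons, mem_beta_cons, List.toFinset_cons, sep, sep, hD, ess, ess,
      steps_insert_of_not_ess he, beta_cons_of_not_ess (hs X le_rfl hX) he]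
    refine and_congr_right fun _ => or_congr_right (and_congr_right fun heg => ?_)
    rw [beta_cons_of_not_ess (hs _ inf_le_left (hX.inf heg.1))
      fun h' => he (h'.mono hX inf_le_left)]
  · rw [List.toFinset_cons, sep, not_not, dirOn_insert]
    exact inf_le_left.trans (not_not.1 (hs X le_rfl hX))
  · rw [List.toFinset_cons]
    exact fun h' => he ⟨h'.1, fun hm => h'.2 (steps_mono (Finset.subset_insert _ _) hm)⟩

lemma ess.not_inf_le {k : Fin n} (hX : A.good X) (hh : A.ess h X C) (he : A.ess g (X ⊓ A.H h) C)
    (hk : k ∈ C) (hak : A.act k X) : ¬ X ⊓ A.H h ⊓ A.H g ≤ A.H k := by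
  intro hle
  have hak' : A.act k (X ⊓ A.H h) := by
    refine ⟨ne_bot_of_le he.1.1 (le_inf inf_le_left hle), fun h' => hh.2 ?_⟩
    rw [cover_eq hX hh.1 hak h']
    exact inf_mem_steps hk hak
  apply he.2
  rw [cover_eq (hX.inf hh.1) he.1 hak' hle]
  exact inf_mem_steps hk hak'

lemma ess.symm_of_inf (hX : A.good X) (hh : A.ess h X C) (hg : A.ess g X C)
    (hne : X ⊓ A.H h ≠ X ⊓ A.H g) (he : A.ess g (X ⊓ A.H h) C) : A.ess h (X ⊓ A.H g) C := by
  refine ⟨⟨?_, inf_not_le hX hg.1 hh.1 hne.symm⟩, fun hm => ?_⟩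
  · rw [inf_right_comm]
    exact he.1.1
  · obtain ⟨k, hk, hak, hke⟩ := mem_steps.1 hm
    refine hh.not_inf_le hX he hk (hak.mono hX inf_le_left) ?_
    rw [inf_right_comm, ← hke]
    exact inf_le_right

lemma ess.swap_mem_relSub {t B : List (Fin n)} (hX : A.good X) (hh : A.ess h X t.toFinset)
    (he : A.ess g (X ⊓ A.H h) t.toFinset) (hB : B ∈ A.beta t (X ⊓ A.H h ⊓ A.H g)) :
    fl (A.flagOf X (h :: g :: B)) + fl (A.flagOf X (g :: h :: B)) ∈
      A.relSub (insert h (insert g t.toFinset)) X := by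
  simp only [flagOf_cons]
  rw [inf_right_comm X (A.H g) (A.H h)]
  have := HArr.swap_mem_relSub (C := insert h (insert g t.toFinset)) hX (by simp) (by simp)
    hh.1 he.1 (Q := A.flagOf (X ⊓ A.H h ⊓ A.H g) B) ?_ ?_
  · rwa [inf_right_comm X (A.H g) (A.H h)] at this
  · refine (mFlag_of_mem_beta ((hX.inf hh.1).inf he.1) hB).congr fun T hT => ?_
    rw [steps_insert_inf_self T (hT.trans inf_le_left),
      steps_insert_inf_self (X := X ⊓ A.H h) T hT]
  · intro k hk hak hle
    rcases Finset.mem_insert.1 hk with rfl | hk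
    · exact Or.inl rfl
    rcases Finset.mem_insert.1 hk with rfl | hk
    · exact Or.inr rfl
    · exact absurd hle (hh.not_inf_le hX he hk hak)

end Permutation

end HArr

namespace HArr

section Permutation

variable {W : Type} [AddCommGroup W] [Module ℂ W] {n : ℕ}
variable {A : HArr W n} {C : Finset (Fin n)} {X Y : AffineSubspace ℂ W} {g h : Fin n}

/-- Exchange the first two entries of a list if these are `h` and `g`. -/
def swapHead (h g : Fin n) : List (Fin n) → List (Fin n)
  | a :: b :: R => if (a = h ∧ b = g) ∨ (a = g ∧ b = h) then b :: a :: R else a :: b :: R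
  | l => l

lemma swapHead_comm (h g : Fin n) : swapHead h g = swapHead g h := by
  funext B
  match B with
  | [] => rfl
  | [a] => rfl
  | a :: b :: R => simp only [swapHead, or_comm]

lemma swapHead_swapHead (B : List (Fin n)) : swapHead h g (swapHead h g B) = B := by
  match B with
  | [] => rfl
  | [a] => rfl
  | a :: b :: R =>
    by_cases hc : (a = h ∧ b = g) ∨ (a = g ∧ b = h)
    · have hc' : (b = h ∧ a = g) ∨ (b = g ∧ a = h) := by tauto
      simp [swapHead, hc, hc']
    · simp [swapHead, hc]

lemma swapHead_of_tail {B : List (Fin n)} (hB : ∀ b ∈ B.tail, b ≠ h ∧ b ≠ g) :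
    swapHead h g B = B := by
  match B with
  | [] => rfl
  | [a] => rfl
  | a :: b :: R =>
    have := hB b (by simp)
    simp [swapHead, this]

lemma swapHead_pair (B : List (Fin n)) : swapHead h g (h :: g :: B) = g :: h :: B := by
  simp [swapHead]

lemma map_swap_eq {t B : List (Fin n)} (hB : ∀ b ∈ B, b ∈ t) (hh : h ∉ t) (hg : g ∉ t) :
    B.map (Equiv.swap h g) = B := by
  conv_rhs => rw [← List.map_id B]
  refine List.map_congr_left fun b hb => Equiv.swap_apply_of_ne_of_ne ?_ ?_
  · rintro rfl
    exact hh (hB b hb)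
  · rintro rfl
    exact hg (hB b hb)

lemma mem_beta_cons_cons {t B : List (Fin n)} (hh : A.ess h X t.toFinset)
    (hg : A.ess g X t.toFinset) (hne : X ⊓ A.H h ≠ X ⊓ A.H g) :
    B ∈ A.beta (h :: g :: t) X ↔
      A.dirOn t.toFinset X ⊓ (A.H g).direction ≤ (A.H h).direction ∧
      ((A.dirOn t.toFinset X ≤ (A.H g).direction ∧
        (B ∈ A.beta t X ∨ ∃ B', B = g :: B' ∧ B' ∈ A.beta t (X ⊓ A.H g))) ∨
      (∃ B', B = h :: B' ∧ A.dirOn t.toFinset X ⊓ (A.H h).direction ≤ (A.H g).direction ∧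
        (B' ∈ A.beta t (X ⊓ A.H h) ∨ A.ess g (X ⊓ A.H h) t.toFinset ∧
          ∃ B'', B' = g :: B'' ∧ B'' ∈ A.beta t (X ⊓ A.H h ⊓ A.H g)))) := by
  have he : A.ess h X (insert g t.toFinset) := by
    refine ⟨hh.1, ?_⟩
    rw [steps_insert_of_act hg.1, Finset.mem_insert, not_or]
    exact ⟨hne, hh.2⟩
  rw [mem_beta_cons, List.toFinset_cons, sep, not_not, dirOn_insert, mem_beta_cons, sep, not_not]
  simp only [mem_beta_cons, sep, not_not, dirOn_inf _ hh.1.1, he, hg, true_and]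

variable [FiniteDimensional ℂ W]

/-- The set of flags attached to `beta`, up to unimodular equivalence, is unchanged under
exchanging the two largest hyperplanes. -/
lemma uniEquiv_swap {t : List (Fin n)} (hX : A.good X) :
    UniEquiv (A.relSub (insert h (insert g t.toFinset)) X)
      (fun B : A.beta (h :: g :: t) X => fl (A.flagOf X B))
      (fun B : A.beta (g :: h :: t) X => fl (A.flagOf X B)) := by
  have same : A.beta (h :: g :: t) X = A.beta (g :: h :: t) X →
      UniEquiv (A.relSub (insert h (insert g t.toFinset)) X)
      (fun B : A.beta (h :: g :: t) X => fl (A.flagOf X B))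
      (fun B : A.beta (g :: h :: t) X => fl (A.flagOf X B)) := by
    intro heq
    refine .of_maps (u := fun B => fl (A.flagOf X B)) id ?_ ?_ ?_ ?_ ?_ <;> simp [heq]
  by_cases hh : A.ess h X t.toFinset
  swap
  · exact same (beta_swap_of_not_ess hX hh)
  by_cases hg : A.ess g X t.toFinset
  swap
  · exact same (beta_swap_of_not_ess hX hg).symm
  have hht : h ∉ t := fun h' => hh.notMem (List.mem_toFinset.2 h')
  have hgt : g ∉ t := fun h' => hg.notMem (List.mem_toFinset.2 h')
  have hmap : ∀ {Y : AffineSubspace ℂ W} {B : List (Fin n)}, B ∈ A.beta t Y →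
      B.map (Equiv.swap h g) = B := fun hB => map_swap_eq (mem_of_mem_beta hB) hht hgt
  have hinv : ∀ B : List (Fin n), (B.map (Equiv.swap h g)).map (Equiv.swap h g) = B := by
    intro B
    rw [List.map_map, ← Equiv.coe_trans, Equiv.swap_swap]
    exact List.map_id B
  by_cases hne : X ⊓ A.H h = X ⊓ A.H g
  · have hbeta : ∀ {a b : Fin n}, A.ess a X t.toFinset → A.ess b X t.toFinset →
        X ⊓ A.H a = X ⊓ A.H b → A.beta (a :: b :: t) X = A.beta (b :: t) X := by
      intro a b ha hb hab
      refine beta_cons_of_not_ess ?_ ?_ <;> rw [List.toFinset_cons]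
      · rw [sep, not_not, dirOn_insert]
        calc A.dirOn t.toFinset X ⊓ (A.H b).direction
            ≤ X.direction ⊓ (A.H b).direction := inf_le_inf_right _ (A.dirOn_le _ _)
          _ = X.direction ⊓ (A.H a).direction := by
              rw [← hb.1.direction_inf, ← hab, ha.1.direction_inf]
          _ ≤ _ := inf_le_right
      · exact fun he => he.2 (hab ▸ inf_mem_steps (Finset.mem_insert_self _ _) hb.1)
    have hsep : A.sep h X t.toFinset ↔ A.sep g X t.toFinset := by
      have : ∀ {a : Fin n}, A.act a X →
          (A.dirOn t.toFinset X ≤ (A.H a).direction ↔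
            A.dirOn t.toFinset X ≤ (X ⊓ A.H a).direction) := by
        intro a ha
        rw [ha.direction_inf, le_inf_iff]
        exact (and_iff_right (A.dirOn_le _ _)).symm
      rw [sep, sep, this hh.1, hne, this hg.1]
    rw [hbeta hh hg hne, hbeta hg hh hne.symm]
    refine .of_maps (u := fun B => fl (A.flagOf X B)) (List.map (Equiv.swap h g))
      ?_ ?_ (fun B _ => hinv B) (fun B _ => hinv B) ?_
    · rintro B ⟨hs, hB | ⟨-, B', rfl, hB⟩⟩
      · exact ⟨hsep.not.2 hs, Or.inl (by rwa [hmap hB])⟩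
      · refine ⟨hsep.not.2 hs, Or.inr ⟨hh, B', ?_, hne ▸ hB⟩⟩
        rw [List.map_cons, hmap hB, Equiv.swap_apply_right]
    · rintro B ⟨hs, hB | ⟨-, B', rfl, hB⟩⟩
      · exact ⟨hsep.not.1 hs, Or.inl (by rwa [hmap hB])⟩
      · refine ⟨hsep.not.1 hs, Or.inr ⟨hg, B', ?_, hne ▸ hB⟩⟩
        rw [List.map_cons, hmap hB, Equiv.swap_apply_left]
    · rintro B ⟨hs, hB | ⟨-, B', rfl, hB⟩⟩
      · left
        rw [hmap hB, sub_self]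
        exact zero_mem _
      · left
        rw [List.map_cons, hmap hB, Equiv.swap_apply_right, flagOf_cons, flagOf_cons, hne,
          sub_self]
        exact zero_mem _
  have hsymm : A.ess g (X ⊓ A.H h) t.toFinset ↔ A.ess h (X ⊓ A.H g) t.toFinset :=
    ⟨hh.symm_of_inf hX hg hne, hg.symm_of_inf hX hh (Ne.symm hne)⟩
  have hDX := (A.dirOn_le t.toFinset X).trans hX.direction_le
  by_cases hsh : A.sep h X t.toFinset <;> by_cases hsg : A.sep g X t.toFinset
  · by_cases hd : A.dirOn t.toFinset X ⊓ (A.H h).direction =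
        A.dirOn t.toFinset X ⊓ (A.H g).direction
    · have hmem : ∀ {a b : Fin n} {B : List (Fin n)}, A.ess a X t.toFinset →
          A.ess b X t.toFinset → A.sep b X t.toFinset → X ⊓ A.H a ≠ X ⊓ A.H b →
          A.sep a X t.toFinset → A.dirOn t.toFinset X ⊓ (A.H a).direction =
            A.dirOn t.toFinset X ⊓ (A.H b).direction → (B ∈ A.beta (a :: b :: t) X ↔
          ∃ B', B = a :: B' ∧ (B' ∈ A.beta t X ∨ A.ess b (X ⊓ A.H a) t.toFinset ∧
            ∃ B'', B' = b :: B'' ∧ B'' ∈ A.beta t (X ⊓ A.H a ⊓ A.H b))) := by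
        intro a b B ha hb hsb hab hsa hd
        rw [mem_beta_cons_cons ha hb hab, beta_inf_of_sep hX hsa]
        have h1 : A.dirOn t.toFinset X ⊓ (A.H a).direction ≤ (A.H b).direction :=
          hd.le.trans inf_le_right
        have h2 : A.dirOn t.toFinset X ⊓ (A.H b).direction ≤ (A.H a).direction :=
          hd.ge.trans inf_le_right
        have h3 : ¬ A.dirOn t.toFinset X ≤ (A.H b).direction := hsb
        simp only [h1, h2, h3, true_and, false_and, false_or]
      refine .of_maps (u := fun B => fl (A.flagOf X B)) (List.map (Equiv.swap h g))
        ?_ ?_ (fun B _ => hinv B) (fun B _ => hinv B) ?_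
      · intro B hB
        rw [hmem hh hg hsg hne hsh hd] at hB
        rw [hmem hg hh hsh (Ne.symm hne) hsg hd.symm]
        obtain ⟨B', rfl, hB | ⟨he, B'', rfl, hB⟩⟩ := hB
        · exact ⟨B', by simp [hmap hB], Or.inl hB⟩
        · exact ⟨h :: B'', by simp [hmap hB], Or.inr ⟨hsymm.1 he, B'', rfl, by
            rwa [inf_right_comm]⟩⟩
      · intro B hB
        rw [hmem hg hh hsh (Ne.symm hne) hsg hd.symm] at hB
        rw [hmem hh hg hsg hne hsh hd]
        obtain ⟨B', rfl, hB | ⟨he, B'', rfl, hB⟩⟩ := hB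
        · exact ⟨B', by simp [hmap hB], Or.inl hB⟩
        · exact ⟨g :: B'', by simp [hmap hB], Or.inr ⟨hsymm.2 he, B'', rfl, by
            rwa [inf_right_comm]⟩⟩
      · intro B hB
        rw [hmem hh hg hsg hne hsh hd] at hB
        right
        obtain ⟨B', rfl, hB | ⟨he, B'', rfl, hB⟩⟩ := hB
        · rw [List.map_cons, hmap hB, Equiv.swap_apply_left]
          exact parallel_mem_relSub hX hsh hsg hd hne (mFlag_of_mem_beta hX hB)
        · rw [List.map_cons, List.map_cons, hmap hB, Equiv.swap_apply_left,
            Equiv.swap_apply_right]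
          exact hh.swap_mem_relSub hX he hB
    · refine same ?_
      ext B
      rw [mem_beta_cons_cons hh hg hne, mem_beta_cons_cons hg hh (Ne.symm hne)]
      have h1 : ¬ A.dirOn t.toFinset X ⊓ (A.H h).direction ≤ (A.H g).direction := fun h' =>
        hd (inf_direction_eq_of_le hDX hsh hsg h')
      have h2 : ¬ A.dirOn t.toFinset X ⊓ (A.H g).direction ≤ (A.H h).direction := fun h' =>
        hd (inf_direction_eq_of_le hDX hsg hsh h').symm
      simp only [h1, h2, false_and]
  · refine same ?_
    ext B
    rw [mem_beta_cons_cons hh hg hne, mem_beta_cons_cons hg hh (Ne.symm hne)]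
    have h1 : ¬ A.dirOn t.toFinset X ≤ (A.H h).direction := hsh
    have h2 : ¬ A.dirOn t.toFinset X ⊓ (A.H g).direction ≤ (A.H h).direction := by
      rwa [inf_eq_left.2 (not_not.1 hsg)]
    simp only [h1, h2, false_and, and_false, exists_false, or_false]
  · refine same ?_
    ext B
    rw [mem_beta_cons_cons hh hg hne, mem_beta_cons_cons hg hh (Ne.symm hne)]
    have h1 : ¬ A.dirOn t.toFinset X ≤ (A.H g).direction := hsg
    have h2 : ¬ A.dirOn t.toFinset X ⊓ (A.H h).direction ≤ (A.H g).direction := by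
      rwa [inf_eq_left.2 (not_not.1 hsh)]
    simp only [h1, h2, false_and, and_false, exists_false, or_false]
  · have hmem : ∀ {a b : Fin n} {B : List (Fin n)}, A.ess a X t.toFinset →
        A.ess b X t.toFinset → ¬ A.sep b X t.toFinset → X ⊓ A.H a ≠ X ⊓ A.H b →
        ¬ A.sep a X t.toFinset → (B ∈ A.beta (a :: b :: t) X ↔
        (B ∈ A.beta t X ∨ ∃ B', B = b :: B' ∧ B' ∈ A.beta t (X ⊓ A.H b)) ∨
        ∃ B', B = a :: B' ∧ (B' ∈ A.beta t (X ⊓ A.H a) ∨ A.ess b (X ⊓ A.H a) t.toFinset ∧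
          ∃ B'', B' = b :: B'' ∧ B'' ∈ A.beta t (X ⊓ A.H a ⊓ A.H b))) := by
      intro a b B ha hb hsb hab hsa
      rw [mem_beta_cons_cons ha hb hab]
      rw [sep, not_not] at hsa hsb
      have h1 : A.dirOn t.toFinset X ⊓ (A.H a).direction ≤ (A.H b).direction :=
        inf_le_left.trans hsb
      have h2 : A.dirOn t.toFinset X ⊓ (A.H b).direction ≤ (A.H a).direction :=
        inf_le_left.trans hsa
      simp only [h1, h2, hsb, true_and]
    have hfix : ∀ {Y : AffineSubspace ℂ W} {B : List (Fin n)}, B ∈ A.beta t Y →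
        ∀ b ∈ B, b ≠ h ∧ b ≠ g := by
      intro Y B hB b hb
      refine ⟨?_, ?_⟩ <;> rintro rfl
      · exact hht (mem_of_mem_beta hB _ hb)
      · exact hgt (mem_of_mem_beta hB _ hb)
    have hfix' : ∀ {Y : AffineSubspace ℂ W} {B : List (Fin n)}, B ∈ A.beta t Y →
        swapHead h g B = B := fun hB =>
      swapHead_of_tail fun b hb => hfix hB b (List.mem_of_mem_tail hb)
    have hfix'' : ∀ {Y : AffineSubspace ℂ W} {B : List (Fin n)} (a : Fin n), B ∈ A.beta t Y →
        swapHead h g (a :: B) = a :: B := fun a hB => swapHead_of_tail (hfix hB)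
    refine .of_maps (u := fun B => fl (A.flagOf X B)) (swapHead h g) ?_ ?_
      (fun B _ => swapHead_swapHead B) (fun B _ => swapHead_swapHead B) ?_
    · intro B hB
      rw [hmem hh hg hsg hne hsh] at hB
      rw [hmem hg hh hsh (Ne.symm hne) hsg]
      obtain (hB | ⟨B', rfl, hB⟩) | ⟨B', rfl, hB | ⟨he, B'', rfl, hB⟩⟩ := hB
      · exact Or.inl (Or.inl (by rwa [hfix' hB]))
      · exact Or.inr ⟨B', hfix'' g hB, Or.inl hB⟩
      · exact Or.inl (Or.inr ⟨B', hfix'' h hB, hB⟩)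
      · exact Or.inr ⟨h :: B'', swapHead_pair B'', Or.inr ⟨hsymm.1 he, B'', rfl, by
          rwa [inf_right_comm]⟩⟩
    · intro B hB
      rw [hmem hg hh hsh (Ne.symm hne) hsg] at hB
      rw [hmem hh hg hsg hne hsh]
      obtain (hB | ⟨B', rfl, hB⟩) | ⟨B', rfl, hB | ⟨he, B'', rfl, hB⟩⟩ := hB
      · exact Or.inl (Or.inl (by rwa [hfix' hB]))
      · exact Or.inr ⟨B', hfix'' h hB, Or.inl hB⟩
      · exact Or.inl (Or.inr ⟨B', hfix'' g hB, hB⟩)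
      · rw [swapHead_comm h g]
        exact Or.inr ⟨g :: B'', swapHead_pair B'', Or.inr ⟨hsymm.2 he, B'', rfl, by
          rwa [inf_right_comm]⟩⟩
    · intro B hB
      rw [hmem hh hg hsg hne hsh] at hB
      obtain (hB | ⟨B', rfl, hB⟩) | ⟨B', rfl, hB | ⟨he, B'', rfl, hB⟩⟩ := hB
      · left
        simp [hfix' hB]
      · left
        simp [hfix'' g hB]
      · left
        simp [hfix'' h hB]
      · right
        rw [swapHead_pair]
        exact hh.swap_mem_relSub hX he hB

/-- Two orderings of the hyperplanes yield unimodularly equivalent families of flags. -/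
theorem uniEquiv_of_perm {l₁ l₂ : List (Fin n)} (hl : l₁.Perm l₂) (hX : A.good X) :
    UniEquiv (A.relSub l₁.toFinset X) (fun B : A.beta l₁ X => fl (A.flagOf X B))
      (fun B : A.beta l₂ X => fl (A.flagOf X B)) := by
  induction hl generalizing X with
  | nil => exact .of_equiv (Equiv.refl _) 1 fun i => by simp
  | swap h g t =>
    rw [List.toFinset_cons, List.toFinset_cons]
    exact uniEquiv_swap hX
  | @trans l₁ l₂ l₃ h₁ h₂ ih₁ ih₂ =>
    have := ih₂ hX
    rw [← List.toFinset_eq_of_perm _ _ h₁] at this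
    exact (ih₁ hX).trans this
  | @cons h l₁ l₂ hl ih =>
    have hf := List.toFinset_eq_of_perm _ _ hl
    rw [List.toFinset_cons]
    by_cases hs : A.sep h X l₁.toFinset
    · have h1 := beta_cons_of_sep hs
      have h2 := beta_cons_of_sep (hf ▸ hs)
      refine .of_maps (u := fun B => fl (A.flagOf X B)) id ?_ ?_ ?_ ?_ ?_ <;> simp [h1, h2]
    · have hs' := hf ▸ hs
      by_cases he : A.ess h X l₁.toFinset
      · have he' := hf ▸ he
        have hsum : UniEquiv (A.relSub (insert h l₁.toFinset) X)
            (Sum.elim (fun B : A.beta l₁ X => fl (A.flagOf X B))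
              (pre (X ⊓ A.H h) ∘ fun B : A.beta l₁ (X ⊓ A.H h) => fl (A.flagOf (X ⊓ A.H h) B)))
            (Sum.elim (fun B : A.beta l₂ X => fl (A.flagOf X B))
              (pre (X ⊓ A.H h) ∘
                fun B : A.beta l₂ (X ⊓ A.H h) => fl (A.flagOf (X ⊓ A.H h) B))) := by
          refine .sum (ih hX) ?_ ((ih (hX.inf he.1)).map _ ?_)
          · refine (relSub_le_insert hX hs).trans (sup_le le_sup_left ?_)
            refine (newSub_le_of (S := A.beta l₂ (X ⊓ A.H h)) fun _ F hF => ?_).trans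
              (sup_le_sup le_rfl (Submodule.span_mono ?_))
            · rw [hf] at hF ⊢
              exact fl_mem_span_beta (hX.inf he.1) hF
            · rintro _ ⟨-, B, hB, rfl⟩
              exact ⟨⟨B, hB⟩, by simp [flagOf_cons]⟩
          · intro x hx
            rw [← relSub_congr fun T hT => steps_insert_inf_self (h := h) T hT] at hx
            exact pre_mem_relSub (inf_mem_steps (Finset.mem_insert_self h _) he.1) hx
        refine (UniEquiv.of_equiv (betaSumEquiv hs he).symm 1 fun B => ?_).trans
          (hsum.trans (.of_equiv (betaSumEquiv hs' he') 1 fun B => ?_))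
        · obtain ⟨B | B, rfl⟩ := (betaSumEquiv hs he).surjective B <;>
            simp [betaSumEquiv_inl, betaSumEquiv_inr, flagOf_cons]
        · rcases B with B | B <;> simp [betaSumEquiv_inl, betaSumEquiv_inr, flagOf_cons]
      · rw [beta_cons_of_not_ess hs he, beta_cons_of_not_ess hs' (hf ▸ he),
          relSub_congr fun T hT => steps_insert_eq hX he hT]
        exact ih hX

end Permutation

end HArr

namespace HArr

section Bases

variable {W : Type} [AddCommGroup W] [Module ℂ W] {n : ℕ}

/-- Intrinsic description of the `βnbc`-bases of the arrangement cut out on `X` by the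
hyperplanes in `C`. -/
structure IsBeta (A : HArr W n) (σ : Equiv.Perm (Fin n)) (X : AffineSubspace ℂ W)
    (C S : Finset (Fin n)) : Prop where
  sub : S ⊆ C
  ne_bot : X ⊓ S.inf A.H ≠ ⊥
  finrank_eq : finrank ℂ X.direction = finrank ℂ (X ⊓ S.inf A.H).direction + S.card
  le : (X ⊓ S.inf A.H).direction ≤ A.dirOn C X
  nbc : ∀ i ∈ C, A.act i X → ¬ X ⊓ (S.filter fun j => σ i < σ j).inf A.H ≤ A.H i
  exch : ∀ i ∈ S, ∃ j ∈ C, σ j < σ i ∧ A.act j (X ⊓ (S.erase i).inf A.H)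

variable {A : HArr W n} {C S : Finset (Fin n)} {X Y : AffineSubspace ℂ W} {h : Fin n}
  {σ : Equiv.Perm (Fin n)}

lemma inf_insert_inf (S : Finset (Fin n)) :
    X ⊓ (insert h S).inf A.H = X ⊓ A.H h ⊓ S.inf A.H := by
  rw [Finset.inf_insert, inf_assoc]

lemma inf_erase_inf (hS : h ∈ S) : X ⊓ A.H h ⊓ (S.erase h).inf A.H = X ⊓ S.inf A.H := by
  rw [← inf_insert_inf, Finset.insert_erase hS]

lemma inf_erase_inf' (hS : h ∈ S) : X ⊓ (S.erase h).inf A.H ⊓ A.H h = X ⊓ S.inf A.H := by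
  rw [inf_right_comm, inf_erase_inf hS]

lemma direction_inf_inf (hne : X ⊓ S.inf A.H ≠ ⊥) :
    (X ⊓ S.inf A.H).direction = A.dirOn S X := by
  induction S using Finset.induction_on generalizing X with
  | empty => simp [dirOn]
  | insert i S hi ih =>
    rw [inf_insert_inf] at hne ⊢
    have hne' := ne_bot_of_le hne inf_le_left
    rw [ih hne, dirOn_insert, dirOn_inf _ hne']

lemma dirOn_le_direction_inf (hS : S ⊆ C) (hne : X ⊓ S.inf A.H ≠ ⊥) :
    A.dirOn C X ≤ (X ⊓ S.inf A.H).direction := by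
  rw [direction_inf_inf hne]
  exact inf_le_inf_left _ (Finset.inf_mono hS)

lemma good.inf_inf (hX : A.good X) (hne : X ⊓ S.inf A.H ≠ ⊥) : A.good (X ⊓ S.inf A.H) :=
  ⟨hne, inf_le_left.trans hX.2⟩

lemma filter_lt_eq_empty (hh : ∀ k ∈ C, σ k < σ h) (hS : S ⊆ insert h C) :
    S.filter (fun j => σ h < σ j) = ∅ := by
  rw [Finset.filter_eq_empty_iff]
  intro j hj hlt
  rcases Finset.mem_insert.1 (hS hj) with rfl | hj
  · exact lt_irrefl _ hlt
  · exact lt_asymm hlt (hh j hj)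

lemma filter_lt_eq_insert {i : Fin n} (hi : σ i < σ h) (hS : h ∈ S) :
    S.filter (fun j => σ i < σ j) = insert h ((S.erase h).filter fun j => σ i < σ j) := by
  conv_lhs => rw [← Finset.insert_erase hS]
  rw [Finset.filter_insert, if_pos hi]

lemma isBeta_insert_of_notMem (hh : ∀ k ∈ C, σ k < σ h) (hS : h ∉ S) :
    A.IsBeta σ X (insert h C) S ↔ ¬ A.sep h X C ∧ A.IsBeta σ X C S := by
  constructor
  · intro hB
    have hSC : S ⊆ C := fun j hj =>
      (Finset.mem_insert.1 (hB.sub hj)).resolve_left fun h' => hS (h' ▸ hj)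
    have hle : (X ⊓ S.inf A.H).direction ≤ A.dirOn C X ⊓ (A.H h).direction := by
      rw [← dirOn_insert]
      exact hB.le
    refine ⟨not_not.2 ?_, hSC, hB.ne_bot, hB.finrank_eq, hle.trans inf_le_left,
      fun i hi => hB.nbc i (Finset.mem_insert_of_mem hi), fun i hi => ?_⟩
    · exact (dirOn_le_direction_inf hSC hB.ne_bot).trans (hle.trans inf_le_right)
    · obtain ⟨j, hj, hji, ha⟩ := hB.exch i hi
      refine ⟨j, (Finset.mem_insert.1 hj).resolve_left ?_, hji, ha⟩
      rintro rfl
      exact lt_asymm hji (hh i (hSC hi))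
  · rintro ⟨hs, hB⟩
    have hSC := hB.sub.trans (Finset.subset_insert h C)
    refine ⟨hSC, hB.ne_bot, hB.finrank_eq, ?_, fun i hi ha => ?_, fun i hi => ?_⟩
    · rw [dirOn_insert, inf_eq_left.2 (not_not.1 hs)]
      exact hB.le
    · rcases Finset.mem_insert.1 hi with rfl | hi
      · rw [filter_lt_eq_empty hh hSC]
        simpa using ha.2
      · exact hB.nbc i hi ha
    · obtain ⟨j, hj, hji, ha⟩ := hB.exch i hi
      exact ⟨j, Finset.mem_insert_of_mem hj, hji, ha⟩

variable [FiniteDimensional ℂ W]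

lemma finrank_le_inf_add (hX : A.good X) (hne : X ⊓ S.inf A.H ≠ ⊥) :
    finrank ℂ X.direction ≤ finrank ℂ (X ⊓ S.inf A.H).direction + S.card := by
  induction S using Finset.induction_on generalizing X with
  | empty => rw [Finset.inf_empty, inf_top_eq, Finset.card_empty, add_zero]
  | insert i S hi ih =>
    rw [inf_insert_inf] at hne ⊢
    have hne' := ne_bot_of_le hne inf_le_left
    rw [Finset.card_insert_of_notMem hi]
    by_cases hle : X ≤ A.H i
    · rw [inf_eq_left.2 hle] at hne ⊢
      have := ih hX hne
      omega
    · have := ih (hX.inf ⟨hne', hle⟩) hne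
      have := finrank_inf hX ⟨hne', hle⟩
      omega

lemma act_erase (hX : A.good X) (hne : X ⊓ S.inf A.H ≠ ⊥)
    (hf : finrank ℂ X.direction = finrank ℂ (X ⊓ S.inf A.H).direction + S.card)
    (hS : h ∈ S) : A.act h (X ⊓ (S.erase h).inf A.H) := by
  rw [← inf_erase_inf' hS] at hne hf
  refine ⟨hne, fun hle => ?_⟩
  rw [inf_eq_left.2 hle] at hf hne
  have := finrank_le_inf_add hX hne
  have := Finset.card_erase_add_one hS
  omega

lemma isBeta_insert_of_mem (hX : A.good X) (hh : ∀ k ∈ C, σ k < σ h) (hS : h ∈ S) :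
    A.IsBeta σ X (insert h C) S ↔
      ¬ A.sep h X C ∧ A.ess h X C ∧ A.IsBeta σ (X ⊓ A.H h) C (S.erase h) := by
  have hcard := Finset.card_erase_add_one hS
  constructor
  · intro hB
    have hSC : S.erase h ⊆ C := fun j hj =>
      (Finset.mem_insert.1 (hB.sub (Finset.mem_of_mem_erase hj))).resolve_left
        (Finset.ne_of_mem_erase hj)
    have hY := act_erase hX hB.ne_bot hB.finrank_eq hS
    have hYne : X ⊓ (S.erase h).inf A.H ≠ ⊥ := ne_bot_of_le hY.1 inf_le_left
    have hgY := hX.inf_inf hYne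
    have hah : A.act h X := hY.mono hX inf_le_left
    refine ⟨not_not.2 ?_, ⟨hah, fun hm => ?_⟩, hSC, ?_, ?_, ?_, fun i hi ha => ?_, fun i hi => ?_⟩
    · obtain ⟨j, hj, hjh, haj⟩ := hB.exch h hS
      have hjC : j ∈ C := (Finset.mem_insert.1 hj).resolve_left fun h' => by
        rw [h'] at hjh
        exact lt_irrefl _ hjh
      have h1 := inf_direction_eq_of_le hgY.direction_le hY.not_direction_le
        haj.not_direction_le (by
          rw [← hY.direction_inf, inf_erase_inf' hS]
          exact hB.le.trans (A.dirOn_le_of_mem X hj))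
      calc A.dirOn C X ≤ (X ⊓ (S.erase h).inf A.H).direction ⊓ (A.H j).direction :=
            le_inf (dirOn_le_direction_inf hSC hYne) (A.dirOn_le_of_mem X hjC)
        _ ≤ (A.H h).direction := h1 ▸ inf_le_right
    · obtain ⟨k, hk, hak, hke⟩ := mem_steps.1 hm
      refine hB.nbc k (Finset.mem_insert_of_mem hk) hak ?_
      calc X ⊓ (S.filter fun j => σ k < σ j).inf A.H ≤ X ⊓ A.H h :=
            inf_le_inf_left _ (Finset.inf_le (Finset.mem_filter.2 ⟨hS, hh k hk⟩))
        _ ≤ A.H k := hke ▸ inf_le_right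
    · rw [inf_erase_inf hS]
      exact hB.ne_bot
    · have := finrank_inf hX hah
      have := hB.finrank_eq
      rw [inf_erase_inf hS]
      omega
    · rw [inf_erase_inf hS, dirOn_inf _ hah.1, ← dirOn_insert]
      exact hB.le
    · have := hB.nbc i (Finset.mem_insert_of_mem hi) (ha.mono hX inf_le_left)
      rwa [filter_lt_eq_insert (hh i hi) hS, inf_insert_inf] at this
    · obtain ⟨j, hj, hji, ha⟩ := hB.exch i (Finset.mem_of_mem_erase hi)
      refine ⟨j, (Finset.mem_insert.1 hj).resolve_left ?_, hji, ?_⟩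
      · rintro rfl
        exact lt_asymm hji (hh i (hSC hi))
      · rwa [Finset.erase_right_comm,
          inf_erase_inf (Finset.mem_erase.2 ⟨(Finset.ne_of_mem_erase hi).symm, hS⟩)]
  · rintro ⟨hs, he, hB⟩
    have hSC : S ⊆ insert h C := by
      rw [← Finset.insert_erase hS]
      exact Finset.insert_subset_insert h hB.sub
    have hne := hB.ne_bot
    have hle := hB.le
    have hfr : finrank ℂ X.direction = finrank ℂ (X ⊓ S.inf A.H).direction + S.card := by
      have := hB.finrank_eq
      rw [inf_erase_inf hS] at this
      have := finrank_inf hX he.1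
      omega
    rw [inf_erase_inf hS] at hne hle
    rw [dirOn_inf _ he.1.1, ← dirOn_insert] at hle
    refine ⟨hSC, hne, hfr, hle, fun i hi ha => ?_, fun i hi => ?_⟩
    · rcases Finset.mem_insert.1 hi with rfl | hi
      · rw [filter_lt_eq_empty hh hSC]
        simpa using ha.2
      · rw [filter_lt_eq_insert (hh i hi) hS, inf_insert_inf]
        by_cases ha' : A.act i (X ⊓ A.H h)
        · exact hB.nbc i hi ha'
        · intro hle
          have hZ : X ⊓ A.H h ⊓ ((S.erase h).filter fun j => σ i < σ j).inf A.H ≠ ⊥ :=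
            ne_bot_of_le hB.ne_bot (inf_le_inf_left _ (Finset.inf_mono (Finset.filter_subset _ _)))
          have hle' : X ⊓ A.H h ≤ A.H i := by
            by_contra hc
            exact ha' ⟨ne_bot_of_le hZ (le_inf inf_le_left hle), hc⟩
          exact he.2 (cover_eq hX he.1 ha hle' ▸ inf_mem_steps hi ha)
    · by_cases hih : i = h
      · subst hih
        have hY := act_erase hX hne hfr hi
        have hYne : X ⊓ (S.erase i).inf A.H ≠ ⊥ := ne_bot_of_le hY.1 inf_le_left
        by_contra hc
        push Not at hc
        refine hY.not_direction_le (le_trans ?_ (not_not.1 hs))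
        refine le_inf (AffineSubspace.direction_le inf_le_left) (Finset.le_inf fun j hj => ?_)
        by_contra hd
        exact hc j (Finset.mem_insert_of_mem hj) (hh j hj)
          ((act_iff (hX.inf_inf hYne)).2 hd)
      · obtain ⟨j, hj, hji, ha⟩ := hB.exch i (Finset.mem_erase.2 ⟨hih, hi⟩)
        refine ⟨j, Finset.mem_insert_of_mem hj, hji, ?_⟩
        rwa [Finset.erase_right_comm,
          inf_erase_inf (Finset.mem_erase.2 ⟨fun h' => hih h'.symm, hS⟩)] at ha

lemma mem_beta_iff {l B : List (Fin n)} (hl : l.Pairwise fun a b => σ b < σ a)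
    (hX : A.good X) : B ∈ A.beta l X ↔ B.Sublist l ∧ A.IsBeta σ X l.toFinset B.toFinset := by
  induction l generalizing X B with
  | nil =>
    rw [List.sublist_nil]
    refine ⟨?_, fun h => h.1⟩
    rintro rfl
    refine ⟨rfl, ?_⟩
    rw [List.toFinset_nil]
    refine ⟨le_rfl, ?_, ?_, ?_, by simp, by simp⟩ <;> rw [Finset.inf_empty, inf_top_eq]
    · exact hX.1
    · simp
    · simp [dirOn]
  | cons h t ih =>
    rw [List.pairwise_cons] at hl
    have hh : ∀ k ∈ t.toFinset, σ k < σ h := fun k hk => hl.1 k (List.mem_toFinset.1 hk)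
    have ht : h ∉ t := fun ht => lt_irrefl _ (hl.1 h ht)
    rw [mem_beta_cons, List.sublist_cons_iff, List.toFinset_cons, ih hl.2 hX]
    constructor
    · rintro ⟨hs, ⟨hB, hB'⟩ | ⟨he, B', rfl, hB⟩⟩
      · have hn : h ∉ B.toFinset := fun h' => ht (hB.subset (List.mem_toFinset.1 h'))
        exact ⟨Or.inl hB, (isBeta_insert_of_notMem hh hn).2 ⟨hs, hB'⟩⟩
      · rw [ih hl.2 (hX.inf he.1)] at hB
        have hn : h ∉ B'.toFinset := fun h' => ht (hB.1.subset (List.mem_toFinset.1 h'))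
        refine ⟨Or.inr ⟨B', rfl, hB.1⟩, (isBeta_insert_of_mem hX hh (by simp)).2 ⟨hs, he, ?_⟩⟩
        rw [List.toFinset_cons, Finset.erase_insert hn]
        exact hB.2
    · rintro ⟨hB | ⟨B', rfl, hB⟩, hB'⟩
      · have hn : h ∉ B.toFinset := fun h' => ht (hB.subset (List.mem_toFinset.1 h'))
        rw [isBeta_insert_of_notMem hh hn] at hB'
        exact ⟨hB'.1, Or.inl ⟨hB, hB'.2⟩⟩
      · have hn : h ∉ B'.toFinset := fun h' => ht (hB.subset (List.mem_toFinset.1 h'))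
        rw [isBeta_insert_of_mem hX hh (by simp), List.toFinset_cons,
          Finset.erase_insert hn] at hB'
        exact ⟨hB'.1, Or.inr ⟨hB'.2.1, B', rfl,
          (ih hl.2 (hX.inf hB'.2.1.1)).2 ⟨hB, hB'.2.2⟩⟩⟩

end Bases

end HArr

namespace HArr

section BetaNbc

variable {W : Type} [AddCommGroup W] [Module ℂ W] {n : ℕ}
  {A : HArr W n} {S T : Finset (Fin n)} {i j : Fin n} {σ : Equiv.Perm (Fin n)}

lemma inter_insert (A : HArr W n) (i : Fin n) (S : Finset (Fin n)) :
    A.inter (insert i S) = A.inter S ⊓ A.H i := by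
  rw [inter, inter, Finset.inf_insert, inf_assoc, inf_comm (A.H i)]

lemma inter_mono (h : T ⊆ S) : A.inter S ≤ A.inter T :=
  inf_le_inf_left _ (Finset.inf_mono h)

lemma inter_le (h : i ∈ S) : A.inter S ≤ A.H i :=
  inf_le_right.trans (Finset.inf_le h)

lemma good_inter (h : A.inter S ≠ ⊥) : A.good (A.inter S) := ⟨h, inf_le_left⟩

lemma dirOn_univ_le (h : A.inter S ≠ ⊥) :
    A.dirOn Finset.univ A.amb ≤ (A.inter S).direction :=
  dirOn_le_direction_inf (Finset.subset_univ S) h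

variable [FiniteDimensional ℂ W]

lemma finrank_inter_le (A : HArr W n) (S : Finset (Fin n)) :
    finrank ℂ (A.inter S).direction ≤ finrank ℂ A.amb.direction :=
  Submodule.finrank_mono (AffineSubspace.direction_le inf_le_left)

lemma indep_iff : A.indep S ↔ A.inter S ≠ ⊥ ∧
    finrank ℂ A.amb.direction = finrank ℂ (A.inter S).direction + S.card := by
  have := A.finrank_inter_le S
  rw [indep, cd]
  refine and_congr_right fun _ => ⟨fun _ => ?_, fun _ => ?_⟩ <;> omega

lemma dep_iff : A.dep S ↔ A.inter S ≠ ⊥ ∧ ¬ A.indep S := by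
  have := A.finrank_inter_le S
  rw [dep, indep, cd]
  refine and_congr_right fun h => ?_
  have : finrank ℂ A.amb.direction ≤ finrank ℂ (A.inter S).direction + S.card :=
    finrank_le_inf_add A.good_amb h
  simp only [h, not_false_eq_true, ne_eq, true_and]
  omega

lemma indep.mono (hS : A.indep S) (h : T ⊆ S) : A.indep T := by
  have hT : A.inter T ≠ ⊥ := ne_bot_of_le hS.1 (inter_mono h)
  have h2 := (indep_iff.1 hS).2
  have h3 : A.inter T ⊓ (S \ T).inf A.H = A.inter S := by
    rw [inter, inter, inf_assoc, ← Finset.inf_union, Finset.union_sdiff_of_subset h]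
  have h4 := finrank_le_inf_add (S := S \ T) (good_inter hT) (h3.symm ▸ hS.1)
  have h5 : finrank ℂ A.amb.direction ≤ finrank ℂ (A.inter T).direction + T.card :=
    finrank_le_inf_add A.good_amb hT
  have h6 := Finset.card_sdiff_add_card_eq_card h
  rw [h3] at h4
  exact indep_iff.2 ⟨hT, by omega⟩

lemma indep_insert (hS : A.indep S) (hi : i ∉ S) :
    A.indep (insert i S) ↔ A.act i (A.inter S) := by
  constructor
  · intro h
    have h' := indep_iff.1 h
    have := act_erase A.good_amb h'.1 h'.2 (Finset.mem_insert_self i S)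
    rwa [Finset.erase_insert hi] at this
  · intro h
    have h1 := finrank_inf (good_inter hS.1) h
    have h2 := (indep_iff.1 hS).2
    rw [indep_iff, inter_insert, Finset.card_insert_of_notMem hi]
    exact ⟨h.1, by omega⟩

lemma isBase_iff :
    A.isBase S ↔ A.indep S ∧ (A.inter S).direction ≤ A.dirOn Finset.univ A.amb := by
  refine and_congr_right fun hS => ⟨fun h => ?_, fun h T hT hST => ?_⟩
  · refine le_inf (good_inter hS.1).direction_le (Finset.le_inf fun i _ => ?_)
    by_contra hd
    have ha := (act_iff (good_inter hS.1)).2 hd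
    have hi : i ∉ S := fun hi => ha.2 (inter_le hi)
    have := h _ ((indep_insert hS hi).2 ha) (Finset.subset_insert i S)
    exact hi (this ▸ Finset.mem_insert_self i S)
  · refine hST.antisymm fun i hi => ?_
    by_contra hiS
    have ha := (indep_insert hS hiS).1 (hT.mono (Finset.insert_subset hi hST))
    exact ha.not_direction_le (h.trans (A.dirOn_le_of_mem _ (Finset.mem_univ i)))

lemma act_amb (A : HArr W n) (i : Fin n) : A.act i A.amb := by
  refine (act_iff A.good_amb).2 fun h => ?_
  have := Submodule.finrank_mono h
  have := A.hyp i
  omega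

lemma nbcSet_iff (hS : A.indep S) :
    A.nbcSet σ S ↔ ∀ i, ¬ A.inter (S.filter fun j => σ i < σ j) ≤ A.H i := by
  constructor
  · intro h i hle
    set F := S.filter fun j => σ i < σ j
    have hF : A.indep F := hS.mono (Finset.filter_subset _ _)
    have hi : i ∉ F := fun hi => lt_irrefl _ (Finset.mem_filter.1 hi).2
    have hd : A.dep (insert i F) := by
      rw [dep_iff, indep_insert hF hi, inter_insert, inf_eq_left.2 hle]
      exact ⟨hF.1, fun ha => ha.2 hle⟩
    obtain ⟨D, hDF, hD⟩ := exists_minimal_le_of_wellFoundedLT A.dep _ hd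
    have hiD : i ∈ D := by
      by_contra hiD
      have hDF' : D ⊆ F := (Finset.subset_insert_iff_of_notMem hiD).1 hDF
      exact (dep_iff.1 hD.prop).2 (hF.mono hDF')
    have hDF' : D.erase i ⊆ F := Finset.subset_insert_iff.1 hDF
    refine h.2 (D.erase i) (hDF'.trans (Finset.filter_subset _ _))
      ⟨i, Finset.notMem_erase i D, fun j hj => (Finset.mem_filter.1 (hDF' hj)).2, ?_⟩
    rw [Finset.insert_erase hiD]
    exact ⟨hD.prop, fun T hT hdT => hD.not_prop_of_lt hT hdT⟩
  · refine fun h => ⟨hS.1, fun T hT hb => ?_⟩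
    obtain ⟨i, hi, hlt, hc⟩ := hb
    have hd := dep_iff.1 hc.1
    rw [indep_insert (hS.mono hT) hi, inter_insert] at hd
    refine h i (le_trans (inter_mono fun j hj => ?_) (not_not.1 fun hn => hd.2 ⟨hd.1, hn⟩))
    exact Finset.mem_filter.2 ⟨hT hj, hlt j hj⟩

lemma isBase_insert_erase (hS : A.isBase S) (hi : i ∈ S) :
    A.isBase (insert j (S.erase i)) ↔ A.act j (A.inter (S.erase i)) := by
  have hE : A.indep (S.erase i) := hS.1.mono (Finset.erase_subset i S)
  by_cases hj : j ∈ S.erase i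
  · rw [Finset.insert_eq_of_mem hj]
    refine ⟨fun h => ?_, fun h => absurd (inter_le hj) h.2⟩
    have := h.2 S hS.1 (Finset.erase_subset i S)
    exact absurd (this.symm ▸ hi) (Finset.notMem_erase i S)
  · rw [isBase_iff, indep_insert hE hj]
    refine ⟨fun h => h.1, fun h => ⟨h, ?_⟩⟩
    have hN := (indep_insert hE hj).2 h
    have h1 := (indep_iff.1 hN).2
    have h2 := (indep_iff.1 hS.1).2
    have h3 := Submodule.finrank_mono (isBase_iff.1 hS).2
    have h4 := Finset.card_insert_of_notMem hj
    have h5 := Finset.card_erase_add_one hi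
    exact (Submodule.eq_of_le_of_finrank_le (dirOn_univ_le hN.1) (by omega)).ge

lemma betaNbcBase_iff : A.betaNbcBase σ S ↔ A.IsBeta σ A.amb Finset.univ S := by
  constructor
  · rintro ⟨⟨hn, hb⟩, he⟩
    have h := indep_iff.1 hb.1
    refine ⟨Finset.subset_univ S, h.1, h.2, (isBase_iff.1 hb).2,
      fun i _ _ => (nbcSet_iff hb.1).1 hn i, fun i hi => ?_⟩
    obtain ⟨j, hji, hj⟩ := he i hi
    exact ⟨j, Finset.mem_univ j, hji, (isBase_insert_erase hb hi).1 hj⟩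
  · intro h
    have hS : A.indep S := indep_iff.2 ⟨h.ne_bot, h.finrank_eq⟩
    have hb : A.isBase S := isBase_iff.2 ⟨hS, h.le⟩
    refine ⟨⟨(nbcSet_iff hS).2 fun i => h.nbc i (Finset.mem_univ i) (A.act_amb i), hb⟩,
      fun i hi => ?_⟩
    obtain ⟨j, -, hji, hj⟩ := h.exch i hi
    exact ⟨j, hji, (isBase_insert_erase hb hi).2 hj⟩

/-- The indices of the hyperplanes, in decreasing order. -/
def descList (σ : Equiv.Perm (Fin n)) : List (Fin n) := ((List.finRange n).map σ.symm).reverse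

lemma descList_pairwise (σ : Equiv.Perm (Fin n)) :
    (descList σ).Pairwise fun a b => σ b < σ a := by
  rw [descList, List.pairwise_reverse, List.pairwise_map]
  simpa using List.pairwise_lt_finRange n

lemma toFinset_descList (σ : Equiv.Perm (Fin n)) : (descList σ).toFinset = Finset.univ := by
  ext i
  simp only [descList, List.toFinset_reverse, List.mem_toFinset, List.mem_map,
    List.mem_finRange, true_and, Finset.mem_univ, iff_true]
  exact ⟨σ i, σ.symm_apply_apply i⟩

lemma nodup_descList (σ : Equiv.Perm (Fin n)) : (descList σ).Nodup :=
  List.nodup_iff_pairwise_ne.2 ((descList_pairwise σ).imp fun h h' => (h' ▸ h).false)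

lemma descList_perm (σ τ : Equiv.Perm (Fin n)) : (descList σ).Perm (descList τ) := by
  refine (List.perm_ext_iff_of_nodup (nodup_descList σ) (nodup_descList τ)).2 fun i => ?_
  rw [← List.mem_toFinset, ← List.mem_toFinset, toFinset_descList, toFinset_descList]

/-- The elements of `S`, in decreasing order. -/
def descOf (σ : Equiv.Perm (Fin n)) (S : Finset (Fin n)) : List (Fin n) :=
  (descList σ).filter (· ∈ S)

lemma toFinset_descOf (σ : Equiv.Perm (Fin n)) (S : Finset (Fin n)) :
    (descOf σ S).toFinset = S := by
  rw [descOf, List.toFinset_filter, toFinset_descList]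
  ext
  simp

lemma descOf_pairwise (σ : Equiv.Perm (Fin n)) (S : Finset (Fin n)) :
    (descOf σ S).Pairwise fun a b => σ b < σ a := (descList_pairwise σ).filter _

lemma nodup_descOf (σ : Equiv.Perm (Fin n)) (S : Finset (Fin n)) : (descOf σ S).Nodup :=
  (nodup_descList σ).filter _

lemma descOf_toFinset {B : List (Fin n)} (hB : B.Sublist (descList σ)) :
    descOf σ B.toFinset = B := by
  have hp : ((descOf σ B.toFinset).map σ).Perm (B.map σ) := by
    refine ((List.perm_ext_iff_of_nodup (nodup_descOf σ _)
      ((nodup_descList σ).sublist hB)).2 fun i => ?_).map σ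
    rw [← List.mem_toFinset, ← List.mem_toFinset, toFinset_descOf]
  refine List.map_injective_iff.2 σ.injective (hp.eq_of_pairwise' (r := fun a b => b < a) ?_ ?_)
  · exact List.pairwise_map.2 (descOf_pairwise σ _)
  · exact List.pairwise_map.2 ((descList_pairwise σ).sublist hB)

/-- The `βnbc`-bases, as the lists generated by deletion and restriction. -/
def betaNbcEquiv (A : HArr W n) (σ : Equiv.Perm (Fin n)) :
    {S : Finset (Fin n) // A.betaNbcBase σ S} ≃ A.beta (descList σ) A.amb where
  toFun S := ⟨descOf σ S.1, (mem_beta_iff (descList_pairwise σ) A.good_amb).2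
    ⟨List.filter_sublist, by
      rw [toFinset_descList, toFinset_descOf]
      exact betaNbcBase_iff.1 S.2⟩⟩
  invFun B := ⟨B.1.toFinset, by
    have := ((mem_beta_iff (descList_pairwise σ) A.good_amb).1 B.2).2
    rw [toFinset_descList] at this
    exact betaNbcBase_iff.2 this⟩
  left_inv S := Subtype.ext (toFinset_descOf σ S.1)
  right_inv B := Subtype.ext
    (descOf_toFinset ((mem_beta_iff (descList_pairwise σ) A.good_amb).1 B.2).1)

end BetaNbc

end HArr

namespace HArr

section Forms

variable {W : Type} [AddCommGroup W] [Module ℂ W] {n : ℕ} {A : HArr W n}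

lemma flagOf_eq_map {σ : Equiv.Perm (Fin n)} {l : List (Fin n)}
    (hl : l.Pairwise fun a b => σ b < σ a) (X : AffineSubspace ℂ W) :
    A.flagOf X l = l.map fun b => X ⊓ (l.toFinset.filter fun j => σ b ≤ σ j).inf A.H := by
  induction l generalizing X with
  | nil => rfl
  | cons h t ih =>
    rw [List.pairwise_cons] at hl
    rw [flagOf_cons, ih hl.2, List.map_cons, List.toFinset_cons, Finset.filter_insert,
      if_pos le_rfl]
    congr 1
    · rw [Finset.filter_eq_empty_iff.2 fun j hj => not_le.2 (hl.1 j (List.mem_toFinset.1 hj))]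
      simp
    · refine List.map_congr_left fun b hb => ?_
      rw [Finset.filter_insert, if_pos (hl.1 b hb).le, inf_insert_inf]

lemma tup_mem (σ : Equiv.Perm (Fin n)) (S : Finset (Fin n)) (p : Fin S.card) :
    tup σ S p ∈ S := by
  obtain ⟨i, hi, h⟩ := Finset.mem_image.1 ((S.image ⇑σ).orderIsoOfFin
    (Finset.card_image_of_injective S σ.injective) p).2
  rw [tup, ← h, Equiv.symm_apply_apply]
  exact hi

lemma tup_strictMono (σ : Equiv.Perm (Fin n)) (S : Finset (Fin n)) :
    StrictMono fun p => σ (tup σ S p) := by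
  intro p q h
  simpa [tup] using h

lemma map_tup_finRange (σ : Equiv.Perm (Fin n)) (S : Finset (Fin n)) :
    (List.finRange S.card).map (tup σ S) = (descOf σ S).reverse := by
  have hs : ((List.finRange S.card).map (tup σ S)).Pairwise fun a b => σ a < σ b :=
    List.pairwise_map.2 ((List.pairwise_lt_finRange S.card).imp fun h => tup_strictMono σ S h)
  have hn : ((List.finRange S.card).map (tup σ S)).Nodup :=
    List.nodup_iff_pairwise_ne.2 (hs.imp fun h h' => (h' ▸ h).false)
  have hS : ((List.finRange S.card).map (tup σ S)).toFinset = S := by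
    refine Finset.eq_of_subset_of_card_le (fun i hi => ?_) ?_
    · obtain ⟨p, -, rfl⟩ := List.mem_map.1 (List.mem_toFinset.1 hi)
      exact tup_mem σ S p
    · rw [List.toFinset_card_of_nodup hn]
      simp
  have hp : (((List.finRange S.card).map (tup σ S)).map σ).Perm
      ((descOf σ S).reverse.map σ) := by
    refine ((List.perm_ext_iff_of_nodup hn (List.nodup_reverse.2 (nodup_descOf σ S))).2
      fun i => ?_).map σ
    rw [← List.mem_toFinset, hS, List.mem_reverse, ← List.mem_toFinset, toFinset_descOf]
  refine List.map_injective_iff.2 σ.injective (hp.eq_of_pairwise' (r := (· < ·)) ?_ ?_)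
  · exact List.pairwise_map.2 hs
  · rw [List.pairwise_map, List.pairwise_reverse]
    exact descOf_pairwise σ S

/-- The product of the forms attached to the members of a flag. -/
def flagProd (A : HArr W n) (lam : Fin n → ℂ) (F : List (AffineSubspace ℂ W)) : OS A :=
  (F.reverse.map (A.omLamX lam)).prod

/-- The linear extension of `flagProd` to chains. -/
def chainProd (A : HArr W n) (lam : Fin n → ℂ) : Chains W →ₗ[ℤ] OS A :=
  Finsupp.linearCombination ℤ (A.flagProd lam)

@[simp] lemma chainProd_fl (lam : Fin n → ℂ) (F : List (AffineSubspace ℂ W)) :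
    A.chainProd lam (fl F) = A.flagProd lam F := by
  simp [chainProd, fl]

lemma flagProd_cons (lam : Fin n → ℂ) (Y : AffineSubspace ℂ W)
    (F : List (AffineSubspace ℂ W)) :
    A.flagProd lam (Y :: F) = A.flagProd lam F * A.omLamX lam Y := by
  simp [flagProd]

lemma chainProd_pre (lam : Fin n → ℂ) (Y : AffineSubspace ℂ W) (x : Chains W) :
    A.chainProd lam (pre Y x) = A.chainProd lam x * A.omLamX lam Y := by
  induction x using Finsupp.induction_linear with
  | zero => simp
  | add x y hx hy => simp only [map_add, hx, hy, add_mul]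
  | single F a =>
    simp [pre, chainProd, flagProd_cons, mul_assoc]

lemma Xi_eq_chainProd (σ : Equiv.Perm (Fin n)) (lam : Fin n → ℂ) (S : Finset (Fin n)) :
    A.Xi σ lam S = A.chainProd lam (fl (A.flagOf A.amb (descOf σ S))) := by
  have h : ((List.finRange S.card).map fun p => A.omLamX lam (A.flag σ S p)) =
      ((List.finRange S.card).map (tup σ S)).map fun b =>
        A.omLamX lam (A.inter (S.filter fun j => σ b ≤ σ j)) := by
    rw [List.map_map]
    rfl
  rw [chainProd_fl, Xi, h, map_tup_finRange, flagOf_eq_map (descOf_pairwise σ S),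
    toFinset_descOf, flagProd, ← List.map_reverse, List.map_map]
  rfl

end Forms

end HArr

namespace HArr

section OrlikSolomon

variable {W : Type} [AddCommGroup W] [Module ℂ W] {n : ℕ} {A : HArr W n}
  {S : Finset (Fin n)} {i k : Fin n} {X Y Z : AffineSubspace ℂ W}

lemma gen_mul_self (i : Fin n) : gen i * gen i = 0 := ExteriorAlgebra.ι_sq_zero _

lemma gen_mul_gen (i j : Fin n) : gen i * gen j = (-1 : ℂ) • (gen j * gen i) := by
  rw [neg_one_smul]
  exact eq_neg_of_add_eq_zero_left (ExteriorAlgebra.ι_add_mul_swap _ _)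

lemma exists_prod_eq_of_perm {l l' : List (Fin n)} (h : l.Perm l') :
    ∃ a : ℂ, (l.map gen).prod = a • (l'.map gen).prod := by
  induction h with
  | nil => exact ⟨1, by simp⟩
  | cons i _ ih =>
    obtain ⟨a, ha⟩ := ih
    exact ⟨a, by simp [ha]⟩
  | swap i j l =>
    refine ⟨-1, ?_⟩
    simp only [List.map_cons, List.prod_cons]
    rw [← mul_assoc, gen_mul_gen, smul_mul_assoc, mul_assoc]
  | trans _ _ ih₁ ih₂ =>
    obtain ⟨a, ha⟩ := ih₁
    obtain ⟨b, hb⟩ := ih₂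
    exact ⟨a * b, by rw [ha, hb, smul_smul]⟩

lemma sort_perm_cons (hi : i ∈ S) :
    (S.sort (· ≤ ·)).Perm (i :: (S.erase i).sort (· ≤ ·)) := by
  refine (List.perm_ext_iff_of_nodup (Finset.sort_nodup _ _)
    (List.nodup_cons.2 ⟨by simp, Finset.sort_nodup _ _⟩)).2 fun j => ?_
  by_cases hj : j = i <;> simp [hj, hi]

lemma exists_gen_mul_eS_erase (hi : i ∈ S) : ∃ a : ℂ, gen i * eS (S.erase i) = a • eS S :=
  exists_prod_eq_of_perm (l := i :: (S.erase i).sort (· ≤ ·)) (sort_perm_cons hi).symm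

lemma exists_eS_eq (hi : i ∈ S) : ∃ a : ℂ, eS S = a • (gen i * eS (S.erase i)) :=
  exists_prod_eq_of_perm (sort_perm_cons hi)

lemma gen_mul_eS_of_mem (hi : i ∈ S) : gen i * eS S = 0 := by
  obtain ⟨a, ha⟩ := exists_eS_eq hi
  rw [ha, mul_smul_comm, ← mul_assoc, gen_mul_self, zero_mul, smul_zero]

lemma gen_mul_bdry (hi : i ∈ S) :
    gen i * bdry S =
      ((-1 : ℂ) ^ (S.filter fun j => j < i).card) • (gen i * eS (S.erase i)) := by
  rw [bdry, Finset.mul_sum, Finset.sum_eq_single_of_mem i hi, mul_smul_comm]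
  intro j _ hj
  rw [mul_smul_comm, gen_mul_eS_of_mem (Finset.mem_erase.2 ⟨hj.symm, hi⟩), smul_zero]

lemma omB_eq_zero_of_inter (h : A.inter S = ⊥) : A.omB S = 0 := by
  rw [omB, osMk, RingQuot.mkAlgHom_rel ℂ (OSRel.isBot S h), map_zero]

lemma omB_eq_zero_of_dep (h : A.dep S) : A.omB S = 0 := by
  obtain ⟨i, hi⟩ := Finset.card_pos.1 ((Nat.zero_le _).trans_lt h.2)
  have h0 : A.osMk (gen i * bdry S) = 0 := by
    rw [map_mul, osMk, RingQuot.mkAlgHom_rel ℂ (OSRel.isDep S h), map_zero, mul_zero]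
  rw [gen_mul_bdry hi, map_smul] at h0
  have h1 := (smul_eq_zero.1 h0).resolve_left (pow_ne_zero _ (by norm_num))
  obtain ⟨a, ha⟩ := exists_eS_eq hi
  rw [omB, ha, map_smul, h1, smul_zero]

lemma om_mul_omB_of_mem (hi : i ∈ S) : A.om i * A.omB S = 0 := by
  rw [om, omB, ← map_mul, gen_mul_eS_of_mem hi, map_zero]

lemma exists_om_mul_omB (hi : i ∉ S) :
    ∃ a : ℂ, A.om i * A.omB S = a • A.omB (insert i S) := by
  obtain ⟨a, ha⟩ := exists_gen_mul_eS_erase (Finset.mem_insert_self i S)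
  rw [Finset.erase_insert hi] at ha
  exact ⟨a, by rw [om, omB, ← map_mul, ha, map_smul, omB]⟩

lemma omLamX_mul_self (lam : Fin n → ℂ) (X : AffineSubspace ℂ W) :
    A.omLamX lam X * A.omLamX lam X = 0 := by
  have h : A.omLamX lam X =
      A.osMk (ExteriorAlgebra.ι ℂ (∑ i ∈ A.sub X, lam i • Pi.single i 1)) := by
    simp only [omLamX, om, gen, map_sum, map_smul]
  rw [h, ← map_mul, ExteriorAlgebra.ι_sq_zero, map_zero]

lemma omLamX_bot (lam : Fin n → ℂ) : A.omLamX lam ⊥ = A.omLam lam := by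
  simp [omLamX, omLam, sub]

/-- The span of the monomials of the independent sets with intersection `X`. -/
def osAt (A : HArr W n) (X : AffineSubspace ℂ W) : Submodule ℂ (OS A) :=
  Submodule.span ℂ {x | ∃ S, A.indep S ∧ A.inter S = X ∧ x = A.omB S}

lemma omB_mem_osAt (hS : A.indep S) : A.omB S ∈ A.osAt (A.inter S) :=
  Submodule.subset_span ⟨S, hS, rfl, rfl⟩

lemma one_mem_osAt_amb : (1 : OS A) ∈ A.osAt A.amb := by
  have h : A.inter ∅ = A.amb := by rw [inter, Finset.inf_empty, inf_top_eq]
  have h1 : A.omB ∅ = 1 := by simp [omB, eS]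
  have := omB_mem_osAt (A := A) (S := ∅) ⟨h ▸ A.good_amb.1, by rw [h]; simp [cd]⟩
  rwa [h, h1] at this

lemma omLamX_mul (lam : Fin n → ℂ) (w : OS A) :
    A.omLamX lam X * w = ∑ k ∈ A.sub X, lam k • (A.om k * w) := by
  rw [omLamX, Finset.sum_mul]
  exact Finset.sum_congr rfl fun k _ => smul_mul_assoc _ _ _

lemma mem_sub : k ∈ A.sub X ↔ X ≤ A.H k := by simp [sub]

variable [FiniteDimensional ℂ W]

lemma om_mul_eq_zero_of_not_act {w : OS A} (hw : w ∈ A.osAt X) (h : ¬ A.act k X) :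
    A.om k * w = 0 := by
  have : A.osAt X ≤ LinearMap.ker (LinearMap.mulLeft ℂ (A.om k)) := by
    refine Submodule.span_le.2 ?_
    rintro _ ⟨S, hS, rfl, rfl⟩
    change A.om k * A.omB S = 0
    by_cases hk : k ∈ S
    · exact om_mul_omB_of_mem hk
    · obtain ⟨a, ha⟩ := exists_om_mul_omB (A := A) hk
      rw [ha, smul_eq_zero]
      right
      by_cases hb : A.inter (insert k S) = ⊥
      · exact omB_eq_zero_of_inter hb
      · exact omB_eq_zero_of_dep (dep_iff.2 ⟨hb, by rwa [indep_insert hS hk]⟩)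
  exact this hw

lemma om_mul_mem_osAt {w : OS A} (hw : w ∈ A.osAt X) (h : A.act k X) :
    A.om k * w ∈ A.osAt (X ⊓ A.H k) := by
  have : A.osAt X ≤ (A.osAt (X ⊓ A.H k)).comap (LinearMap.mulLeft ℂ (A.om k)) := by
    refine Submodule.span_le.2 ?_
    rintro _ ⟨S, hS, rfl, rfl⟩
    change A.om k * A.omB S ∈ A.osAt (A.inter S ⊓ A.H k)
    have hk : k ∉ S := fun hk => h.2 (inter_le hk)
    obtain ⟨a, ha⟩ := exists_om_mul_omB (A := A) hk
    rw [ha, ← inter_insert]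
    exact Submodule.smul_mem _ _ (omB_mem_osAt ((indep_insert hS hk).2 h))
  exact this hw

lemma omLamX_mul_mem_osAt (lam : Fin n → ℂ) (hX : A.good X)
    (hY : Y ∈ A.steps Finset.univ X) {w : OS A} (hw : w ∈ A.osAt X) :
    A.omLamX lam Y * w ∈ A.osAt Y := by
  obtain ⟨i, -, hi, rfl⟩ := mem_steps.1 hY
  rw [omLamX_mul]
  refine Submodule.sum_mem _ fun k hk => Submodule.smul_mem _ _ ?_
  by_cases ha : A.act k X
  · rw [cover_eq hX hi ha (mem_sub.1 hk)]
    exact om_mul_mem_osAt hw ha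
  · rw [om_mul_eq_zero_of_not_act hw ha]
    exact zero_mem _

lemma sum_steps_omLamX_mul (lam : Fin n → ℂ) (hX : A.good X) (hZ : Z ≤ X) {w : OS A}
    (hw : w ∈ A.osAt X) :
    ∑ T ∈ (A.steps Finset.univ X).filter (Z ≤ ·), A.omLamX lam T * w =
      A.omLamX lam Z * w := by
  have hsum (T : AffineSubspace ℂ W) : A.omLamX lam T * w =
      ∑ k ∈ (A.sub T).filter fun k => A.act k X, lam k • (A.om k * w) := by
    rw [omLamX_mul, Finset.sum_filter_of_ne]
    intro k _ hk
    by_contra ha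
    exact hk (by rw [om_mul_eq_zero_of_not_act hw ha, smul_zero])
  rw [hsum Z, ← Finset.sum_fiberwise_of_maps_to
    (t := (A.steps Finset.univ X).filter (Z ≤ ·)) (g := fun k => X ⊓ A.H k)]
  · refine Finset.sum_congr rfl fun T hT => ?_
    rw [hsum T]
    refine Finset.sum_congr ?_ fun _ _ => rfl
    rw [Finset.mem_filter, mem_steps] at hT
    obtain ⟨⟨i, -, hi, rfl⟩, hT⟩ := hT
    ext k
    simp only [Finset.mem_filter, mem_sub]
    constructor
    · rintro ⟨h, ha⟩
      exact ⟨⟨hT.trans h, ha⟩, (cover_eq hX hi ha h).symm⟩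
    · rintro ⟨⟨-, ha⟩, h⟩
      exact ⟨h ▸ inf_le_right, ha⟩
  · intro k hk
    simp only [Finset.mem_filter, mem_sub] at hk ⊢
    exact ⟨inf_mem_steps (Finset.mem_univ k) hk.2, le_inf hZ hk.1⟩

lemma rank_eq_card (hS : A.isBase S) : A.rank = S.card := by
  rw [rank, rankOn]
  refine le_antisymm (Finset.sup_le fun T _ => ?_) ?_
  · split_ifs with hT
    · have h1 := (indep_iff.1 hT).2
      have h2 := (indep_iff.1 hS.1).2
      have h3 := Submodule.finrank_mono ((isBase_iff.1 hS).2.trans (dirOn_univ_le hT.1))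
      omega
    · exact Nat.zero_le _
  · have := Finset.le_sup (f := fun S => if A.indep S then S.card else 0)
      (Finset.mem_powerset.2 (Finset.subset_univ S))
    simpa only [if_pos hS.1] using this

lemma osAt_le_deg (hX : A.good X) (hY : Y ∈ A.steps Finset.univ X)
    (h : A.steps Finset.univ Y = ∅) : A.osAt X ≤ A.deg (A.rank - 1) := by
  refine Submodule.span_le.2 ?_
  rintro _ ⟨S, hS, rfl, rfl⟩
  refine Submodule.subset_span ⟨S, ?_, rfl⟩
  have hd := (steps_eq_empty_iff (hX.step hY)).1 h
  rw [dirOn_step hY] at hd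
  obtain ⟨k, -, hk, rfl⟩ := mem_steps.1 hY
  have hkS : k ∉ S := fun hkS => hk.2 (inter_le hkS)
  have hB : A.isBase (insert k S) := by
    rw [isBase_iff, indep_insert hS hkS, inter_insert]
    refine ⟨hk, hd.le.trans ?_⟩
    exact inf_le_inf_right _ hX.direction_le
  rw [rank_eq_card hB, Finset.card_insert_of_notMem hkS, Nat.add_sub_cancel]

lemma FlagRel.chainProd_mul_mem (lam : Fin n → ℂ) {x : Chains W}
    (hx : A.FlagRel Finset.univ X x) (hX : A.good X) {w : OS A} (hw : w ∈ A.osAt X) :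
    A.chainProd lam x * w ∈ A.Ideg lam (A.rank - 1) := by
  induction hx generalizing w with
  | last X h =>
    rcases (A.steps Finset.univ X).eq_empty_or_nonempty with he | ⟨Y, hY⟩
    · rw [he, Finset.sum_empty, map_zero, zero_mul]
      exact zero_mem _
    · refine ⟨w, osAt_le_deg hX hY (h Y hY) hw, ?_⟩
      rw [LinearMap.mulLeft_apply, ← omLamX_bot, ← sum_steps_omLamX_mul lam hX bot_le hw,
        Finset.filter_true_of_mem fun _ _ => bot_le, map_sum, Finset.sum_mul]
      simp [flagProd]
  | two X Y Z Q hY hZ _ =>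
    have h := sum_steps_omLamX_mul lam hX ((le_of_mem_steps hZ).trans (le_of_mem_steps hY)) hw
    have h0 : A.chainProd lam
        (∑ T ∈ (A.steps Finset.univ X).filter (Z ≤ ·), fl (T :: Z :: Q)) * w = 0 := by
      simp only [map_sum, chainProd_fl, flagProd_cons, Finset.sum_mul, mul_assoc]
      rw [← Finset.mul_sum, ← Finset.mul_sum, h, ← mul_assoc (A.omLamX lam Z),
        omLamX_mul_self, zero_mul, mul_zero]
    rw [h0]
    exact zero_mem _
  | cons X Y x hY _ ih =>
    rw [chainProd_pre, mul_assoc]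
    exact ih (hX.step hY) (omLamX_mul_mem_osAt lam hX hY hw)

lemma chainProd_mem_Ideg (lam : Fin n → ℂ) {x : Chains W}
    (hx : x ∈ A.relSub Finset.univ A.amb) :
    A.chainProd lam x ∈ A.Ideg lam (A.rank - 1) := by
  have : A.relSub Finset.univ A.amb ≤
      ((A.Ideg lam (A.rank - 1)).restrictScalars ℤ).comap (A.chainProd lam) := by
    refine Submodule.span_le.2 fun x hx => ?_
    have := FlagRel.chainProd_mul_mem lam hx A.good_amb one_mem_osAt_amb
    rwa [mul_one] at this
  exact this hx

end OrlikSolomon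

end HArr

section Matrices

variable {M ι κ : Type*} [AddCommGroup M] [Fintype κ] [DecidableEq ι]

lemma sum_apply_single_mul (e : (ι →₀ ℤ) ≃ₗ[ℤ] (κ →₀ ℤ)) (i j : ι) :
    ∑ k, e (Finsupp.single i 1) k * e.symm (Finsupp.single k 1) j = if i = j then 1 else 0 := by
  have h := e.symm_apply_apply (Finsupp.single i 1)
  rw [← (e (Finsupp.single i 1)).univ_sum_single, map_sum] at h
  have hs (k : κ) : Finsupp.single k (e (Finsupp.single i 1) k) =
      e (Finsupp.single i 1) k • Finsupp.single k (1 : ℤ) := by simp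
  simp only [hs, map_smul] at h
  rw [← Finsupp.single_apply, ← h]
  simp [Finsupp.finsetSum_apply]

lemma UniEquiv.exists_matrices [Fintype ι] [DecidableEq κ] {N : Submodule ℤ M} {u : ι → M} {v : κ → M}
    (h : UniEquiv N u v) :
    ∃ (c : ι → κ → ℤ) (d : κ → ι → ℤ),
      (∀ i j, ∑ k, c i k * d k j = if i = j then 1 else 0) ∧
      (∀ i j, ∑ k, d i k * c k j = if i = j then 1 else 0) ∧
      ∀ i, u i - ∑ k, c i k • v k ∈ N := by
  obtain ⟨e, h⟩ := h
  refine ⟨fun i => e (Finsupp.single i 1), fun k => e.symm (Finsupp.single k 1),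
    sum_apply_single_mul e, fun i j => ?_, fun i => ?_⟩
  · simpa using sum_apply_single_mul e.symm i j
  · have := h (Finsupp.single i 1)
    rwa [Finsupp.linearCombination_single, one_smul,
      Finsupp.linearCombination_apply, Finsupp.sum_fintype _ _ fun k => zero_smul ℤ (v k)] at this

end Matrices

namespace HArr

section Transition

variable {W : Type} [AddCommGroup W] [Module ℂ W] [FiniteDimensional ℂ W] {n : ℕ}

lemma uniEquiv_betaNbc (A : HArr W n) (σ τ : Equiv.Perm (Fin n)) :
    UniEquiv (A.relSub Finset.univ A.amb)
      (fun S : {S : Finset (Fin n) // A.betaNbcBase σ S} => fl (A.flagOf A.amb (descOf σ S.1)))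
      (fun S : {S : Finset (Fin n) // A.betaNbcBase τ S} =>
        fl (A.flagOf A.amb (descOf τ S.1))) := by
  have h := uniEquiv_of_perm (descList_perm σ τ) A.good_amb
  rw [toFinset_descList] at h
  refine (UniEquiv.of_equiv (A.betaNbcEquiv σ) 1 fun S => ?_).trans
    (h.trans (.of_equiv (A.betaNbcEquiv τ).symm 1 fun B => ?_))
  · simp [betaNbcEquiv]
  · have := descOf_toFinset ((mem_beta_iff (descList_pairwise τ) A.good_amb).1 B.2).1
    simp [betaNbcEquiv, this]

end Transition

end HArr

/-- For two linear orders on `𝒜` (encoded by permutations `σ₁`, `σ₂`),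
there is an integral unimodular matrix `c`, independent of `λ`, relating the two families
of forms `Ξ₁`, `Ξ₂` modulo `ω_λ ∧ A^{r−1}`, for every `λ` with `λ(X) ≠ 0` for all dense
`X ∈ L ∖ {V}`. -/
theorem transition_matrix_integral_unimodular {W : Type} [AddCommGroup W] [Module ℂ W]
    [FiniteDimensional ℂ W] {n : ℕ} (A : HArr W n) (σ₁ σ₂ : Equiv.Perm (Fin n)) :
    ∃ (c : {S : Finset (Fin n) // A.betaNbcBase σ₂ S} →
           {S : Finset (Fin n) // A.betaNbcBase σ₁ S} → ℤ)
      (d : {S : Finset (Fin n) // A.betaNbcBase σ₁ S} →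
           {S : Finset (Fin n) // A.betaNbcBase σ₂ S} → ℤ),
      (∀ B B', (∑ B'', c B B'' * d B'' B') = if B = B' then 1 else 0) ∧
      (∀ B B', (∑ B'', d B B'' * c B'' B') = if B = B' then 1 else 0) ∧
      (∀ lam : Fin n → ℂ,
        (∀ X, A.memL X → X ≠ A.amb → A.denseL X → A.lamX lam X ≠ 0) →
        ∀ B : {S : Finset (Fin n) // A.betaNbcBase σ₂ S},
          A.Xi σ₂ lam B.1 -
              ∑ B' : {S : Finset (Fin n) // A.betaNbcBase σ₁ S},
                (c B B' : ℂ) • A.Xi σ₁ lam B'.1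
            ∈ A.Ideg lam (A.rank - 1)) := by
  obtain ⟨c, d, hcd, hdc, h⟩ := (A.uniEquiv_betaNbc σ₂ σ₁).exists_matrices
  refine ⟨c, d, hcd, hdc, fun lam _ B => ?_⟩
  have := HArr.chainProd_mem_Ideg lam (h B)
  simpa only [HArr.Xi_eq_chainProd, map_sub, map_sum, map_zsmul, Int.cast_smul_eq_zsmul]
    using this
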